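/- arXiv:1907.06816 — 4 statements merged into one kernel-verified Lean document; each statement's English description precedes it below -/
import Mathlib

section
/- Let n ≥ 1, p ≥ 2 and q > 0. If u : ℝ^n → ℝ is a positive, bounded, twice continuously differentiable function satisfying -Δu = u^q |∇u|^p at every point of ℝ^n, then u is constant. -/
/-- The Laplacian of `u : ℝⁿ → ℝ` at `x`, defined as the sum of the pure second
partial derivatives in the coordinate directions. -/
noncomputable def lap {n : ℕ} (u : EuclideanSpace ℝ (Fin n) → ℝ)
    (x : EuclideanSpace ℝ (Fin n)) : ℝ :=
  ∑ i : Fin n,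
    fderiv ℝ (fun y => fderiv ℝ u y (EuclideanSpace.single i (1 : ℝ))) x
      (EuclideanSpace.single i (1 : ℝ))

open Set Filter Topology

/-- The concave profile `r ↦ A log (1 + c r / A)`, which has slope `c` at the origin and
whose second derivative is `-1 / A` times the square of its first derivative. -/
noncomputable def logProfile (A c r : ℝ) : ℝ := A * Real.log (1 + c * r / A)

lemma logProfile_zero (A c : ℝ) : logProfile A c 0 = 0 := by simp [logProfile]

lemma logProfile_mono {A c r s : ℝ} (hA : 0 < A) (hc : 0 < c) (hr : 0 ≤ r) (hrs : r ≤ s) :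
    logProfile A c r ≤ logProfile A c s := by
  unfold logProfile
  gcongr

lemma logProfile_le {A c r : ℝ} (hA : 0 < A) (hc : 0 < c) (hr : 0 ≤ r) :
    logProfile A c r ≤ c * r := by
  have h : 0 < 1 + c * r / A := by positivity
  calc A * Real.log (1 + c * r / A) ≤ A * (c * r / A) := by
        have := Real.log_le_sub_one_of_pos h
        gcongr
        linarith
    _ = c * r := by field_simp

lemma one_add_le_exp_of_logProfile_le {A c r M : ℝ} (hA : 0 < A) (hc : 0 < c) (hr : 0 ≤ r)
    (h : logProfile A c r ≤ M) : 1 + c * r / A ≤ Real.exp (M / A) := by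
  have hpos : 0 < 1 + c * r / A := by positivity
  rw [← Real.log_le_iff_le_exp hpos, le_div_iff₀ hA, mul_comm]
  exact h

lemma hasDerivAt_logProfile {A c r : ℝ} (hA : A ≠ 0) (h : 1 + c * r / A ≠ 0) :
    HasDerivAt (logProfile A c) (c / (1 + c * r / A)) r := by
  have h1 : HasDerivAt (fun s : ℝ => 1 + c * s / A) (c / A) r := by
    simpa using (((hasDerivAt_id r).const_mul c).div_const A).const_add 1
  refine ((h1.log h).const_mul A).congr_deriv ?_
  field_simp

lemma hasDerivAt_deriv_logProfile {A c r : ℝ} (h : 1 + c * r / A ≠ 0) :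
    HasDerivAt (fun s => c / (1 + c * s / A)) (-(c / (1 + c * r / A)) ^ 2 / A) r := by
  have h1 : HasDerivAt (fun s : ℝ => 1 + c * s / A) (c / A) r := by
    simpa using (((hasDerivAt_id r).const_mul c).div_const A).const_add 1
  refine ((hasDerivAt_const r c).div h1 h).congr_deriv ?_
  rw [div_pow]
  ring

lemma HasDerivAt.nonneg_of_forall_le {h : ℝ → ℝ} {h' : ℝ} (hd : HasDerivAt h h' 0)
    (hmin : ∀ t, 0 ≤ t → h 0 ≤ h t) : 0 ≤ h' := by
  have hs := (hasDerivAt_iff_tendsto_slope_zero.1 hd).mono_left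
    (nhdsWithin_mono (0 : ℝ) (show Ioi (0 : ℝ) ⊆ {0}ᶜ from fun t ht => ne_of_gt ht))
  refine ge_of_tendsto hs ?_
  filter_upwards [self_mem_nhdsWithin] with t (ht : 0 < t)
  have := hmin t ht.le
  simp only [zero_add, smul_eq_mul]
  have : 0 ≤ h t - h 0 := by linarith
  positivity

lemma IsLocalMax.second_deriv_nonpos {g g' : ℝ → ℝ} {g'' a : ℝ} (hmax : IsLocalMax g a)
    (h1 : ∀ᶠ t in 𝓝 a, HasDerivAt g (g' t) t) (h2 : HasDerivAt g' g'' a) : g'' ≤ 0 := by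
  by_contra! hpos
  have hde : deriv g =ᶠ[𝓝 a] g' := h1.mono fun t ht => ht.deriv
  have hdd : deriv (deriv g) a = g'' := hde.deriv_eq.trans h2.deriv
  have hmin : IsLocalMin g a :=
    isLocalMin_of_deriv_deriv_pos (by rw [hdd]; exact hpos) hmax.deriv_eq_zero
      h1.self_of_nhds.continuousAt
  have hconst : g =ᶠ[𝓝 a] fun _ => g a := by
    filter_upwards [hmin, hmax] with t h h' using le_antisymm h' h
  have h0 : deriv (deriv g) a = 0 := by
    rw [hconst.deriv.deriv_eq]
    simp
  linarith

section InnerProduct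

variable {E : Type*} [NormedAddCommGroup E] [InnerProductSpace ℝ E]

lemma hasDerivAt_comp_line {u : E → ℝ} (hu : Differentiable ℝ u) (x v : E) (t : ℝ) :
    HasDerivAt (fun s : ℝ => u (x + s • v)) (fderiv ℝ u (x + t • v) v) t := by
  have hl : HasDerivAt (fun s : ℝ => x + s • v) v t := by
    simpa using ((hasDerivAt_id t).smul_const v).const_add x
  exact (hu _).hasFDerivAt.comp_hasDerivAt t hl

lemma hasDerivAt_fderiv_comp_line {u : E → ℝ} (hu : ContDiff ℝ 2 u) (x v : E) (t : ℝ) :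
    HasDerivAt (fun s : ℝ => fderiv ℝ u (x + s • v) v)
      (fderiv ℝ (fderiv ℝ u) (x + t • v) v v) t := by
  have hl : HasDerivAt (fun s : ℝ => x + s • v) v t := by
    simpa using ((hasDerivAt_id t).smul_const v).const_add x
  have hd : Differentiable ℝ (fderiv ℝ u) :=
    (hu.fderiv_right (m := 1) (by norm_num)).differentiable (by norm_num)
  have := ((hd _).hasFDerivAt.comp_hasDerivAt t hl).clm_apply (hasDerivAt_const t v)
  simpa using this

lemma hasDerivAt_norm_sq_line (x v : E) (t : ℝ) :
    HasDerivAt (fun s : ℝ => ‖x + s • v‖ ^ 2) (2 * inner ℝ x v + 2 * t * ‖v‖ ^ 2) t := by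
  have h : (fun s : ℝ => ‖x + s • v‖ ^ 2)
      = fun s => ‖x‖ ^ 2 + s * (2 * inner ℝ x v) + s ^ 2 * ‖v‖ ^ 2 := by
    funext s
    rw [norm_add_sq_real, norm_smul, inner_smul_right, mul_pow, Real.norm_eq_abs, sq_abs]
    ring
  rw [h]
  have := (((hasDerivAt_id t).mul_const (2 * inner ℝ x v)).const_add (‖x‖ ^ 2)).add
    (((hasDerivAt_id t).pow 2).mul_const (‖v‖ ^ 2))
  refine this.congr_deriv ?_
  simp

/-- The doubled function `u x - u y`, penalised by the distance of the two points and by the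
size of `x`. -/
noncomputable def doubled (u : E → ℝ) (A c ε : ℝ) (x y : E) : ℝ :=
  u x - u y - logProfile A c ‖x - y‖ - ε * ‖x‖ ^ 2

lemma exists_isMax_doubled [FiniteDimensional ℝ E] {u : E → ℝ} (hu : Continuous u) {M : ℝ}
    (h0 : ∀ x, 0 ≤ u x) (hM : ∀ x, u x ≤ M) {A c ε : ℝ} (hA : 0 < A) (hc : 0 < c) (hε : 0 < ε)
    {a b : E} (hab : 0 < doubled u A c ε a b) :
    ∃ x y, 0 < doubled u A c ε x y ∧ ∀ x' y', doubled u A c ε x' y' ≤ doubled u A c ε x y := by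
  set R : ℝ := M / ε + 1
  set L : ℝ := A * Real.exp (M / A) / c
  set S : Set (E × E) := Metric.closedBall 0 R ×ˢ Metric.closedBall 0 (R + L)
  have hS : IsCompact S := (isCompact_closedBall _ _).prod (isCompact_closedBall _ _)
  have hmem : ∀ x y, 0 < doubled u A c ε x y → (x, y) ∈ S := by
    intro x y h
    have hψ0 : 0 ≤ logProfile A c ‖x - y‖ := by
      simpa [logProfile_zero] using logProfile_mono hA hc le_rfl (norm_nonneg (x - y))
    have h1 := h0 y
    have h2 := hM x
    have h3 : 0 ≤ ε * ‖x‖ ^ 2 := by positivity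
    unfold doubled at h
    have h4 : ‖x‖ ^ 2 ≤ M / ε := by
      rw [le_div_iff₀ hε]; linarith
    have h5 : ‖x‖ ≤ R := by
      simp only [R]
      nlinarith [sq_nonneg (‖x‖ - 1), norm_nonneg x]
    have h6 := one_add_le_exp_of_logProfile_le hA hc (norm_nonneg (x - y))
      (show logProfile A c ‖x - y‖ ≤ M by linarith)
    have h7 : ‖x - y‖ ≤ L := by
      have : c * ‖x - y‖ / A ≤ Real.exp (M / A) := by linarith
      rw [div_le_iff₀ hA] at this
      simp only [L]
      rw [le_div_iff₀ hc]
      linarith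
    have h8 : ‖y‖ ≤ ‖x‖ + ‖x - y‖ := by
      have := norm_sub_le x (x - y)
      simpa using this
    simp only [S, mem_prod, mem_closedBall_zero_iff]
    exact ⟨h5, by linarith⟩
  have hcont : Continuous fun z : E × E => doubled u A c ε z.1 z.2 := by
    unfold doubled logProfile
    have : ∀ z : E × E, 1 + c * ‖z.1 - z.2‖ / A ≠ 0 := fun z => by positivity
    fun_prop (disch := assumption)
  obtain ⟨z, -, hz⟩ := hS.exists_isMaxOn ⟨(a, b), hmem a b hab⟩ hcont.continuousOn
  have hzab : 0 < doubled u A c ε z.1 z.2 := hab.trans_le (hz (hmem a b hab))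
  refine ⟨z.1, z.2, hzab, fun x' y' => ?_⟩
  by_cases h : 0 < doubled u A c ε x' y'
  · exact hz (hmem x' y' h)
  · linarith

lemma fderiv_le_of_isMax_doubled {u : E → ℝ} (hu : Differentiable ℝ u) {A c ε : ℝ}
    (hA : 0 < A) (hc : 0 < c) (hε : 0 < ε) {x y : E}
    (hmax : ∀ x' y', doubled u A c ε x' y' ≤ doubled u A c ε x y) (v : E) :
    fderiv ℝ u x v ≤ (c / (1 + c * ‖x - y‖ / A) + 2 * ε * ‖x‖) * ‖v‖ := by
  have hpos : 0 < 1 + c * ‖x - y‖ / A := by positivity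
  have hψ : HasDerivAt (fun t : ℝ => logProfile A c (‖x - y‖ + t * ‖v‖))
      (c / (1 + c * ‖x - y‖ / A) * ‖v‖) 0 := by
    have h1 : HasDerivAt (fun t : ℝ => ‖x - y‖ + t * ‖v‖) ‖v‖ 0 := by
      simpa using ((hasDerivAt_id (0 : ℝ)).mul_const ‖v‖).const_add ‖x - y‖
    exact HasDerivAt.comp (0 : ℝ) (h₂ := logProfile A c)
      (by simpa using hasDerivAt_logProfile hA.ne' hpos.ne') h1
  have hd := (hψ.add ((hasDerivAt_norm_sq_line x v 0).const_mul ε)).sub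
    (hasDerivAt_comp_line hu x v 0)
  have hnn := hd.nonneg_of_forall_le fun t ht => by
    have h1 := hmax (x + t • v) y
    have h2 : ‖x + t • v - y‖ ≤ ‖x - y‖ + t * ‖v‖ := by
      have := norm_add_le (x - y) (t • v)
      rw [norm_smul, Real.norm_of_nonneg ht] at this
      rwa [add_sub_right_comm]
    have h3 := logProfile_mono hA hc (norm_nonneg _) h2
    simp only [doubled] at h1
    simp only [Pi.add_apply, Pi.sub_apply, zero_smul, zero_mul, add_zero]
    linarith
  have hin : inner ℝ x v ≤ ‖x‖ * ‖v‖ := real_inner_le_norm x v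
  simp only [zero_smul, add_zero, mul_zero, zero_mul] at hnn
  nlinarith

lemma second_deriv_le_of_isMax_doubled {u : E → ℝ} (hu : ContDiff ℝ 2 u) {A c ε : ℝ}
    (hA : 0 < A) (hc : 0 < c) {x y : E} (hxy : x ≠ y)
    (hmax : ∀ x' y', doubled u A c ε x' y' ≤ doubled u A c ε x y) (v : E) :
    fderiv ℝ (fderiv ℝ u) x v v
      - fderiv ℝ (fderiv ℝ u) y ((ℝ ∙ (x - y)).reflection v) ((ℝ ∙ (x - y)).reflection v)
      ≤ -(4 / A) * (c / (1 + c * ‖x - y‖ / A)) ^ 2 * (inner ℝ (x - y) v / ‖x - y‖) ^ 2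
        + 2 * ε * ‖v‖ ^ 2 := by
  set r := ‖x - y‖ with hr
  have hr0 : 0 < r := norm_pos_iff.2 (sub_ne_zero.2 hxy)
  set w := (ℝ ∙ (x - y)).reflection v with hw
  set k : ℝ := 2 * (inner ℝ (x - y) v / r) with hk
  have hd : Differentiable ℝ u := hu.differentiable (by norm_num)
  have hline : ∀ t : ℝ, HasDerivAt (fun s : ℝ => r + s * k) k t := fun t => by
    simpa using ((hasDerivAt_id t).mul_const k).const_add r
  have hev : ∀ᶠ t : ℝ in 𝓝 0, 0 < r + t * k := by
    have : ContinuousAt (fun t : ℝ => r + t * k) 0 := (hline 0).continuousAt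
    exact this.eventually (lt_mem_nhds (by simpa using hr0))
  have hnorm : ∀ t : ℝ, ‖x + t • v - (y + t • (-w))‖ = |r + t * k| := by
    intro t
    have h1 : x + t • v - (y + t • (-w)) = (1 + t * k / r) • (x - y) := by
      rw [hw, Submodule.reflection_singleton_apply, hk]
      simp only [RCLike.ofReal_real_eq_id, id_eq, ← hr]
      have : t * (2 * (inner ℝ (x - y) v / r)) / r = t * (2 * (inner ℝ (x - y) v / r ^ 2)) := by
        field_simp
      rw [this]
      module
    rw [h1, norm_smul, ← hr, Real.norm_eq_abs, ← abs_of_pos hr0, ← abs_mul, abs_of_pos hr0]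
    congr 1
    field_simp
  set g : ℝ → ℝ := fun t => u (x + t • v) - u (y + t • (-w)) - logProfile A c (r + t * k)
    - ε * ‖x + t • v‖ ^ 2 with hg
  have hgmax : IsLocalMax g 0 := by
    filter_upwards [hev] with t ht
    have := hmax (x + t • v) (y + t • (-w))
    simp only [doubled, hnorm, abs_of_pos ht] at this
    simpa [hg] using this
  have h1 : ∀ᶠ t in 𝓝 (0 : ℝ), HasDerivAt g
      (fderiv ℝ u (x + t • v) v - fderiv ℝ u (y + t • (-w)) (-w)
        - c / (1 + c * (r + t * k) / A) * k - ε * (2 * inner ℝ x v + 2 * t * ‖v‖ ^ 2)) t := by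
    filter_upwards [hev] with t ht
    have hpos : 0 < 1 + c * (r + t * k) / A := by positivity
    exact (((hasDerivAt_comp_line hd x v t).sub (hasDerivAt_comp_line hd y (-w) t)).sub
      ((hasDerivAt_logProfile hA.ne' hpos.ne').comp t (hline t))).sub
      ((hasDerivAt_norm_sq_line x v t).const_mul ε)
  have hpos : 0 < 1 + c * (r + 0 * k) / A := by
    rw [zero_mul, add_zero]; positivity
  have hlin : HasDerivAt (fun t : ℝ => 2 * inner ℝ x v + 2 * t * ‖v‖ ^ 2) (2 * ‖v‖ ^ 2) 0 := by
    simpa using (((hasDerivAt_id (0 : ℝ)).const_mul 2).mul_const (‖v‖ ^ 2)).const_add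
      (2 * inner ℝ x v)
  have h2 := (((hasDerivAt_fderiv_comp_line hu x v 0).sub
    (hasDerivAt_fderiv_comp_line hu y (-w) 0)).sub
      ((HasDerivAt.comp (0 : ℝ) (hasDerivAt_deriv_logProfile hpos.ne') (hline 0)).mul_const k)).sub
      (hlin.const_mul ε)
  have hle := hgmax.second_deriv_nonpos h1 h2
  simp only [zero_smul, add_zero, zero_mul, map_neg, neg_apply, neg_neg] at hle
  rw [hk] at hle
  have e : -(4 / A) * (c / (1 + c * r / A)) ^ 2 * (inner ℝ (x - y) v / r) ^ 2
      = -(c / (1 + c * r / A)) ^ 2 / A * (2 * (inner ℝ (x - y) v / r))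
        * (2 * (inner ℝ (x - y) v / r)) := by ring
  rw [e]
  linarith

end InnerProduct

section Laplacian

variable {n : ℕ}

lemma lap_eq_sum_orthonormalBasis {u : EuclideanSpace ℝ (Fin n) → ℝ} (hu : ContDiff ℝ 2 u)
    (b : OrthonormalBasis (Fin n) ℝ (EuclideanSpace ℝ (Fin n)))
    (x : EuclideanSpace ℝ (Fin n)) :
    lap u x = ∑ i, fderiv ℝ (fderiv ℝ u) x (b i) (b i) := by
  have hd : Differentiable ℝ (fderiv ℝ u) :=
    (hu.fderiv_right (m := 1) (by norm_num)).differentiable (by norm_num)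
  have key : ∀ b : OrthonormalBasis (Fin n) ℝ (EuclideanSpace ℝ (Fin n)),
      Laplacian.laplacian u x = ∑ i, fderiv ℝ (fderiv ℝ u) x (b i) (b i) := fun b => by
    rw [InnerProductSpace.laplacian_eq_iteratedFDeriv_orthonormalBasis u b]
    simp [iteratedFDeriv_two_apply]
  rw [← key b, key (EuclideanSpace.basisFun (Fin n) ℝ), lap]
  refine Finset.sum_congr rfl fun i _ => ?_
  rw [fderiv_clm_apply (hd x) (differentiableAt_const _)]
  simp

lemma lap_sub_lap_le_of_isMax_doubled {u : EuclideanSpace ℝ (Fin n) → ℝ} (hu : ContDiff ℝ 2 u)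
    {A c ε : ℝ} (hA : 0 < A) (hc : 0 < c) {x y : EuclideanSpace ℝ (Fin n)} (hxy : x ≠ y)
    (hmax : ∀ x' y', doubled u A c ε x' y' ≤ doubled u A c ε x y) :
    lap u x - lap u y ≤ -(4 / A) * (c / (1 + c * ‖x - y‖ / A)) ^ 2 + 2 * ε * n := by
  have hr : ‖x - y‖ ≠ 0 := norm_ne_zero_iff.2 (sub_ne_zero.2 hxy)
  set b := EuclideanSpace.basisFun (Fin n) ℝ
  rw [lap_eq_sum_orthonormalBasis hu b x,
    lap_eq_sum_orthonormalBasis hu (b.map (ℝ ∙ (x - y)).reflection) y, ← Finset.sum_sub_distrib]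
  refine (Finset.sum_le_sum fun i _ =>
    second_deriv_le_of_isMax_doubled hu hA hc hxy hmax (b i)).trans_eq ?_
  simp_rw [div_pow (inner ℝ _ _), b.norm_eq_one]
  rw [Finset.sum_add_distrib, ← Finset.mul_sum, ← Finset.sum_div, b.sum_sq_inner_left,
    div_self (pow_ne_zero 2 hr)]
  simp only [one_pow, mul_one, Finset.sum_const, Finset.card_univ, Fintype.card_fin, nsmul_eq_mul]
  ring

end Laplacian

/-- **Liouville-type theorem** (Theorem 1.1): for `p ≥ 2` and `q > 0`, any positive bounded
classical solution of `-Δu = u^q |∇u|^p` in `ℝⁿ` is constant. -/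
theorem liouville_superquadratic {n : ℕ} (hn : 1 ≤ n) {p q : ℝ} (hp : 2 ≤ p) (hq : 0 < q)
    (u : EuclideanSpace ℝ (Fin n) → ℝ)
    (hu_pos : ∀ x, 0 < u x)
    (hu_bdd : ∃ M : ℝ, ∀ x, u x ≤ M)
    (hu_C2 : ContDiff ℝ 2 u)
    (heq : ∀ x, -lap u x = u x ^ q * ‖gradient u x‖ ^ p) :
    ∀ x y, u x = u y := by
  obtain ⟨M, hM⟩ := hu_bdd
  have hM0 : 0 < M := (hu_pos 0).trans_le (hM 0)
  have hd : Differentiable ℝ u := hu_C2.differentiable (by norm_num)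
  suffices h : ∀ a b, u a ≤ u b from fun x y => le_antisymm (h x y) (h y x)
  intro a b
  by_contra! hab
  set K := M ^ q
  have hK : 0 < K := Real.rpow_pos_of_pos hM0 q
  obtain ⟨A, hA, hAK⟩ : ∃ A : ℝ, 0 < A ∧ 4 / A = 2 * K + 1 :=
    ⟨4 / (2 * K + 1), by positivity, by field_simp⟩
  -- A slope so small that the linear barrier already fails at `(a, b)`.
  obtain ⟨c, hc, hc2, hcab⟩ : ∃ c : ℝ, 0 < c ∧ c ≤ 1 / 2 ∧ c * ‖a - b‖ < u a - u b := by
    have h : ∀ᶠ c : ℝ in 𝓝[>] 0, c * ‖a - b‖ < u a - u b := by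
      refine nhdsWithin_le_nhds ?_
      have : ContinuousAt (fun c : ℝ => c * ‖a - b‖) 0 := by fun_prop
      exact this.eventually (gt_mem_nhds (by simpa using hab))
    obtain ⟨c, ⟨hc, hc0⟩, hc1⟩ := ((h.and self_mem_nhdsWithin).and
      (nhdsWithin_le_nhds (Iic_mem_nhds (show (0 : ℝ) < 1 / 2 by norm_num)))).exists
    exact ⟨c, hc0, hc1, hc⟩
  set γ := c / Real.exp (M / A)
  have hγ0 : 0 < γ := by positivity
  -- A penalisation weight so small that its contributions stay below the strict gap.
  obtain ⟨ε, hε, hεa, hεM, hεγ⟩ : ∃ ε : ℝ, 0 < ε ∧ ε * ‖a‖ ^ 2 < u a - u b - c * ‖a - b‖ ∧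
      ε * (4 * M) < 1 / 4 ∧ ε * (2 * n + 8 * K * M) < γ ^ 2 := by
    have h : ∀ k m : ℝ, 0 < m → ∀ᶠ ε : ℝ in 𝓝[>] 0, ε * k < m := fun k m hm => by
      refine nhdsWithin_le_nhds ?_
      have : ContinuousAt (fun ε : ℝ => ε * k) 0 := by fun_prop
      exact this.eventually (gt_mem_nhds (by simpa using hm))
    obtain ⟨ε, ⟨⟨h1, h2⟩, h3⟩, h4⟩ := (((h (‖a‖ ^ 2) (u a - u b - c * ‖a - b‖) (by linarith)).and
      (h (4 * M) (1 / 4) (by norm_num))).and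
      (h (2 * n + 8 * K * M) (γ ^ 2) (by positivity))).and self_mem_nhdsWithin |>.exists
    exact ⟨ε, h4, h1, h2, h3⟩
  have hab0 : 0 < doubled u A c ε a b := by
    have := logProfile_le hA hc (norm_nonneg (a - b))
    unfold doubled
    linarith
  obtain ⟨x, y, hpos, hmax⟩ := exists_isMax_doubled hu_C2.continuous (fun x => (hu_pos x).le) hM
    hA hc hε hab0
  have hxy : x ≠ y := by
    rintro rfl
    have : 0 ≤ ε * ‖x‖ ^ 2 := by positivity
    simp only [doubled, sub_self, norm_zero, logProfile_zero] at hpos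
    linarith
  have hlap := lap_sub_lap_le_of_isMax_doubled hu_C2 hA hc hxy hmax
  have hfd := fderiv_le_of_isMax_doubled hd hA hc hε hmax (gradient u x)
  have hψ0 : 0 ≤ logProfile A c ‖x - y‖ := by
    simpa [logProfile_zero] using logProfile_mono hA hc le_rfl (norm_nonneg (x - y))
  have hx0 : 0 ≤ ε * ‖x‖ ^ 2 := by positivity
  unfold doubled at hpos
  have hexp := one_add_le_exp_of_logProfile_le hA hc (norm_nonneg (x - y))
    (show logProfile A c ‖x - y‖ ≤ M by linarith [hM x, hu_pos y])
  have hεx : ε * ‖x‖ ^ 2 ≤ M := by linarith [hM x, hu_pos y]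
  have hden : 1 ≤ 1 + c * ‖x - y‖ / A := by
    have : 0 ≤ c * ‖x - y‖ / A := by positivity
    linarith
  set P := c / (1 + c * ‖x - y‖ / A)
  have hP0 : 0 < P := by positivity
  have hPγ : γ ≤ P := div_le_div_of_nonneg_left hc.le (by linarith) hexp
  have hPc : P ≤ 1 / 2 := (div_le_self hc.le hden).trans hc2
  set η := 2 * ε * ‖x‖
  have hη0 : 0 ≤ η := by positivity
  have hη : η ^ 2 ≤ ε * (4 * M) := by
    calc η ^ 2 = 4 * ε * (ε * ‖x‖ ^ 2) := by ring
      _ ≤ 4 * ε * M := by gcongr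
      _ = ε * (4 * M) := by ring
  have hη2 : η ≤ 1 / 2 := by nlinarith
  have hgrad : ‖gradient u x‖ ≤ P + η := by
    have h1 : fderiv ℝ u x (gradient u x) = ‖gradient u x‖ ^ 2 := by
      rw [← real_inner_self_eq_norm_sq, gradient, InnerProductSpace.toDual_symm_apply]
    rw [h1] at hfd
    by_contra! h
    nlinarith [norm_nonneg (gradient u x)]
  have hpow : ‖gradient u x‖ ^ p ≤ (P + η) ^ 2 := by
    calc ‖gradient u x‖ ^ p ≤ ‖gradient u x‖ ^ (2 : ℝ) :=
          Real.rpow_le_rpow_of_exponent_ge' (norm_nonneg _) (by linarith) (by norm_num) hp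
      _ = ‖gradient u x‖ ^ 2 := Real.rpow_two _
      _ ≤ (P + η) ^ 2 := by gcongr
  have hlapx : -lap u x ≤ K * (P + η) ^ 2 := by
    rw [heq x]
    gcongr
    exact Real.rpow_le_rpow (hu_pos x).le (hM x) hq.le
  have hlapy : 0 ≤ -lap u y := by
    rw [heq y]
    have := hu_pos y
    positivity
  rw [hAK] at hlap
  have hsq : (P + η) ^ 2 ≤ 2 * P ^ 2 + 2 * (ε * (4 * M)) := by nlinarith [sq_nonneg (P - η)]
  have hKsq := mul_le_mul_of_nonneg_left hsq hK.le
  have hγP : γ ^ 2 ≤ P ^ 2 := by gcongr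
  linarith
end

section
/- Let n ≥ 1, p ≥ 2 and q ∈ ℝ with q > 1 - p. If u : ℝ^n → ℝ is a positive, bounded, twice continuously differentiable function satisfying -Δu = u^q |∇u|^p at every point of ℝ^n, then u is constant. -/
open Set Filter Topology MeasureTheory

namespace SuperquadraticLiouville

variable {n : ℕ}

/-- Euclidean space of dimension `n`. -/
local notation "𝔼" n => EuclideanSpace ℝ (Fin n)

/-- The `i`-th standard basis vector. -/
noncomputable abbrev stdVec {n : ℕ} (i : Fin n) : EuclideanSpace ℝ (Fin n) := EuclideanSpace.single i (1 : ℝ)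

theorem differentiable_fderiv_apply {f : (𝔼 n) → ℝ} (hf : ContDiff ℝ 2 f) (a : 𝔼 n) :
    Differentiable ℝ (fun y => fderiv ℝ f y a) :=
  ((hf.fderiv_right (m := 1) (by norm_num)).clm_apply contDiff_const).differentiable (by norm_num)

theorem contDiff_fderiv_apply {f : (𝔼 n) → ℝ} (hf : ContDiff ℝ 2 f) (a : 𝔼 n) :
    ContDiff ℝ 1 (fun y => fderiv ℝ f y a) :=
  (hf.fderiv_right (m := 1) (by norm_num)).clm_apply contDiff_const

theorem continuous_lap {f : (𝔼 n) → ℝ} (hf : ContDiff ℝ 2 f) : Continuous (lap f) :=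
  continuous_finsetSum _ fun _ _ =>
    ((contDiff_fderiv_apply hf _).continuous_fderiv (by norm_num)).clm_apply continuous_const

theorem fderiv_fderiv_apply_comm {f : (𝔼 n) → ℝ} (hf : ContDiff ℝ 2 f) (x a b : 𝔼 n) :
    fderiv ℝ (fun y => fderiv ℝ f y a) x b = fderiv ℝ (fun y => fderiv ℝ f y b) x a := by
  have hd : DifferentiableAt ℝ (fderiv ℝ f) x :=
    (hf.fderiv_right (m := 1) (by norm_num)).differentiable (by norm_num) x
  have key : ∀ a b : 𝔼 n, fderiv ℝ (fun y => fderiv ℝ f y a) x b = fderiv ℝ (fderiv ℝ f) x b a := by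
    intro a b
    rw [fderiv_clm_apply hd (differentiableAt_const a)]
    simp
  rw [key, key]
  exact (hf.contDiffAt.isSymmSndFDerivAt (by simp)) b a

theorem lap_sub {f g : (𝔼 n) → ℝ} (hf : ContDiff ℝ 2 f) (hg : ContDiff ℝ 2 g) (x : 𝔼 n) :
    lap (fun y => f y - g y) x = lap f x - lap g x := by
  unfold lap
  rw [← Finset.sum_sub_distrib]
  refine Finset.sum_congr rfl fun i _ => ?_
  have : (fun y => fderiv ℝ (fun y => f y - g y) y (stdVec i)) =
      fun y => fderiv ℝ f y (stdVec i) - fderiv ℝ g y (stdVec i) := by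
    funext y
    rw [fderiv_fun_sub (hf.differentiable (by norm_num) y) (hg.differentiable (by norm_num) y)]
    rfl
  rw [this, fderiv_fun_sub (differentiable_fderiv_apply hf _ x)
    (differentiable_fderiv_apply hg _ x)]
  rfl

theorem lap_const_mul {f : (𝔼 n) → ℝ} (hf : ContDiff ℝ 2 f) (c : ℝ) (x : 𝔼 n) :
    lap (fun y => c * f y) x = c * lap f x := by
  unfold lap
  rw [Finset.mul_sum]
  refine Finset.sum_congr rfl fun i _ => ?_
  have : (fun y => fderiv ℝ (fun y => c * f y) y (stdVec i)) =
      fun y => c * fderiv ℝ f y (stdVec i) := by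
    funext y
    rw [fderiv_const_mul (hf.differentiable (by norm_num) y)]
    rfl
  rw [this, fderiv_const_mul (differentiable_fderiv_apply hf _ x)]
  rfl

theorem lap_mul {f g : (𝔼 n) → ℝ} (hf : ContDiff ℝ 2 f) (hg : ContDiff ℝ 2 g) (x : 𝔼 n) :
    lap (fun y => f y * g y) x = f x * lap g x
      + 2 * ∑ i, fderiv ℝ f x (stdVec i) * fderiv ℝ g x (stdVec i) + g x * lap f x := by
  unfold lap
  rw [Finset.mul_sum, Finset.mul_sum, Finset.mul_sum, ← Finset.sum_add_distrib,
    ← Finset.sum_add_distrib]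
  refine Finset.sum_congr rfl fun i _ => ?_
  have hf1 := hf.differentiable (by norm_num)
  have hg1 := hg.differentiable (by norm_num)
  have : (fun y => fderiv ℝ (fun y => f y * g y) y (stdVec i)) =
      fun y => f y * fderiv ℝ g y (stdVec i) + g y * fderiv ℝ f y (stdVec i) := by
    funext y
    rw [fderiv_fun_mul (hf1 y) (hg1 y)]
    rfl
  have hf2 := differentiable_fderiv_apply hf (stdVec i)
  have hg2 := differentiable_fderiv_apply hg (stdVec i)
  rw [this, fderiv_fun_add ((hf1 x).fun_mul (hg2 x)) ((hg1 x).fun_mul (hf2 x)),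
    fderiv_fun_mul (hf1 x) (hg2 x), fderiv_fun_mul (hg1 x) (hf2 x)]
  simp only [add_apply, smul_apply, smul_eq_mul]
  ring

theorem fderiv_comp_add_smul {f : (𝔼 n) → ℝ} (hf : Differentiable ℝ f) (c : 𝔼 n) (r : ℝ)
    (x a : 𝔼 n) : fderiv ℝ (fun y => f (c + r • y)) x a = r * fderiv ℝ f (c + r • x) a := by
  have h : HasFDerivAt (fun y : 𝔼 n => c + r • y) (r • ContinuousLinearMap.id ℝ (𝔼 n)) x :=
    ((hasFDerivAt_id x).const_smul r).const_add c
  have := ((hf (c + r • x)).hasFDerivAt.comp x h).fderiv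
  rw [show (fun y => f (c + r • y)) = f ∘ (fun y => c + r • y) from rfl, this]
  simp

theorem fderiv_comp_add_right' (f : (𝔼 n) → ℝ) (c x a : 𝔼 n) :
    fderiv ℝ (fun y => f (y + c)) x a = fderiv ℝ f (x + c) a := by
  rw [fderiv_comp_add_right]

theorem lap_comp_add_right (f : (𝔼 n) → ℝ) (c x : 𝔼 n) :
    lap (fun y => f (y + c)) x = lap f (x + c) := by
  unfold lap
  refine Finset.sum_congr rfl fun i _ => ?_
  simp_rw [fderiv_comp_add_right' f]
  exact fderiv_comp_add_right' (fun y => fderiv ℝ f y (stdVec i)) c x _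

theorem norm_gradient_eq (f : (𝔼 n) → ℝ) (x : 𝔼 n) : ‖gradient f x‖ = ‖fderiv ℝ f x‖ := by
  rw [← toDual_gradient, LinearIsometryEquiv.norm_map]

theorem inner_gradient (f : (𝔼 n) → ℝ) (x a : 𝔼 n) : inner ℝ (gradient f x) a = fderiv ℝ f x a := by
  rw [← toDual_gradient]
  rfl

theorem gradient_apply (f : (𝔼 n) → ℝ) (x : 𝔼 n) (i : Fin n) :
    gradient f x i = fderiv ℝ f x (stdVec i) := by
  rw [← inner_gradient, EuclideanSpace.inner_single_right]
  simp

theorem norm_gradient_sq (f : (𝔼 n) → ℝ) (x : 𝔼 n) :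
    ‖gradient f x‖ ^ 2 = ∑ i, fderiv ℝ f x (stdVec i) ^ 2 := by
  rw [EuclideanSpace.norm_sq_eq]
  simp [gradient_apply]

theorem sum_fderiv_mul_fderiv (f g : (𝔼 n) → ℝ) (x : 𝔼 n) :
    ∑ i, fderiv ℝ f x (stdVec i) * fderiv ℝ g x (stdVec i) = fderiv ℝ f x (gradient g x) := by
  rw [← inner_gradient f, PiLp.inner_apply]
  simp [gradient_apply, mul_comm]

theorem hasFDerivAt_rpow_comp {u : (𝔼 n) → ℝ} (hu : Differentiable ℝ u) (hpos : ∀ x, 0 < u x)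
    (r : ℝ) (x : 𝔼 n) :
    HasFDerivAt (fun y => u y ^ r) ((r * u x ^ (r - 1)) • fderiv ℝ u x) x :=
  (hu x).hasFDerivAt.rpow_const (Or.inl (hpos x).ne')

theorem lap_rpow {u : (𝔼 n) → ℝ} (hu : ContDiff ℝ 2 u) (hpos : ∀ x, 0 < u x) (r : ℝ) (x : 𝔼 n) :
    lap (fun y => u y ^ r) x = r * u x ^ (r - 1) * lap u x
      + r * (r - 1) * u x ^ (r - 2) * ‖gradient u x‖ ^ 2 := by
  have hu1 := hu.differentiable (by norm_num)
  rw [norm_gradient_sq]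
  unfold lap
  rw [Finset.mul_sum, Finset.mul_sum, ← Finset.sum_add_distrib]
  refine Finset.sum_congr rfl fun i _ => ?_
  have : (fun y => fderiv ℝ (fun y => u y ^ r) y (stdVec i)) =
      fun y => (r * u y ^ (r - 1)) * fderiv ℝ u y (stdVec i) := by
    funext y
    rw [(hasFDerivAt_rpow_comp hu1 hpos r y).fderiv]
    rfl
  have h2 := differentiable_fderiv_apply hu (stdVec i) x
  rw [this, (((hasFDerivAt_rpow_comp hu1 hpos (r - 1) x).const_mul r).fun_mul h2.hasFDerivAt).fderiv]
  simp only [add_apply, smul_apply, smul_eq_mul]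
  rw [show r - 1 - 1 = r - 2 by ring]
  ring

theorem contDiff_norm_sub_sq (c : 𝔼 n) : ContDiff ℝ 2 (fun y : 𝔼 n => ‖y - c‖ ^ 2) :=
  (contDiff_id.sub contDiff_const).norm_sq ℝ

theorem fderiv_norm_sub_sq (c x a : 𝔼 n) :
    fderiv ℝ (fun y : 𝔼 n => ‖y - c‖ ^ 2) x a = 2 * inner ℝ (x - c) a := by
  have h : HasFDerivAt (fun y : 𝔼 n => y - c) (ContinuousLinearMap.id ℝ (𝔼 n)) x :=
    (hasFDerivAt_id x).sub_const c
  rw [h.norm_sq.fderiv]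
  simp [inner_sub_left]

theorem lap_norm_sub_sq (c x : 𝔼 n) : lap (fun y : 𝔼 n => ‖y - c‖ ^ 2) x = 2 * n := by
  unfold lap
  have : ∀ i : Fin n, fderiv ℝ (fun y : 𝔼 n => fderiv ℝ (fun y : 𝔼 n => ‖y - c‖ ^ 2) y (stdVec i))
      x (stdVec i) = 2 := by
    intro i
    have h0 : (fun y : 𝔼 n => fderiv ℝ (fun y : 𝔼 n => ‖y - c‖ ^ 2) y (stdVec i)) =
        fun y => 2 * (inner ℝ (stdVec i) (y - c)) := by
      funext y
      rw [fderiv_norm_sub_sq, real_inner_comm]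
    have h : HasFDerivAt (fun y : 𝔼 n => y - c) (ContinuousLinearMap.id ℝ (𝔼 n)) x :=
      (hasFDerivAt_id x).sub_const c
    have h1 := ((innerSL ℝ (stdVec i : 𝔼 n)).hasFDerivAt.comp x h).const_mul (2 : ℝ)
    rw [h0]
    have h2 : fderiv ℝ (fun y : 𝔼 n => 2 * (inner ℝ (stdVec i) (y - c))) x = _ := h1.fderiv
    rw [h2]
    simp
  simp only [this]
  simp [mul_comm]

theorem deriv_deriv_nonpos_of_isLocalMax {g : ℝ → ℝ} {t : ℝ} (hc : ContinuousAt g t)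
    (hmax : IsLocalMax g t) : deriv (deriv g) t ≤ 0 := by
  by_contra! hpos
  have hmin := isLocalMin_of_deriv_deriv_pos hpos hmax.deriv_eq_zero hc
  have hconst : g =ᶠ[𝓝 t] fun _ => g t := by
    filter_upwards [hmax, hmin] with s h1 h2 using le_antisymm h1 h2
  have := (hconst.deriv.deriv).eq_of_nhds
  simp at this
  linarith

theorem lap_nonpos_of_isLocalMax {f : (𝔼 n) → ℝ} (hf : ContDiff ℝ 2 f) {x : 𝔼 n}
    (hmax : IsLocalMax f x) : lap f x ≤ 0 := by
  refine Finset.sum_nonpos fun i _ => ?_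
  have hline : ∀ s : ℝ, HasDerivAt (fun s : ℝ => x + s • (stdVec i : 𝔼 n)) (stdVec i) s := fun s => by
    simpa using ((hasDerivAt_id s).smul_const (stdVec i : 𝔼 n)).const_add x
  have hd : ∀ {h : (𝔼 n) → ℝ}, Differentiable ℝ h → deriv (fun s : ℝ => h (x + s • stdVec i)) =
      fun s => fderiv ℝ h (x + s • stdVec i) (stdVec i) := by
    intro h hh
    funext s
    exact ((hh _).hasFDerivAt.comp_hasDerivAt s (hline s)).deriv
  have hcont : ContinuousAt (fun s : ℝ => x + s • (stdVec i : 𝔼 n)) 0 :=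
    (hline 0).continuousAt
  have h0 : x + (0 : ℝ) • (stdVec i : 𝔼 n) = x := by simp
  have hloc : IsLocalMax (fun s : ℝ => f (x + s • stdVec i)) 0 := by
    have : Tendsto (fun s : ℝ => x + s • (stdVec i : 𝔼 n)) (𝓝 0) (𝓝 x) := by
      simpa only [ContinuousAt, h0] using hcont
    have h2 := this.eventually hmax
    filter_upwards [h2] with s hs
    simpa only [h0] using hs
  have := deriv_deriv_nonpos_of_isLocalMax
    (g := fun s : ℝ => f (x + s • stdVec i)) (t := 0)
    (hf.continuous.continuousAt.comp_of_eq hcont rfl) hloc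
  rw [hd (hf.differentiable (by norm_num)),
    hd (h := fun y => fderiv ℝ f y (stdVec i)) (differentiable_fderiv_apply hf _)] at this
  simpa only [h0] using this

/-- Second-order condition at a maximum of `η ∂ₑv`, where `∂ₑv` is only once differentiable but the
Laplacian of `v` is `C¹`: the formal Laplacian of `η ∂ₑv` is nonpositive there. -/
theorem second_order_of_isLocalMax {η v : (𝔼 n) → ℝ} (hη : ContDiff ℝ 2 η) (hv : ContDiff ℝ 2 v)
    (hlap : ContDiff ℝ 1 (lap v)) {x₁ e : 𝔼 n}
    (hmax : IsLocalMax (fun x => η x * fderiv ℝ v x e) x₁) :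
    η x₁ * fderiv ℝ (lap v) x₁ e
      + 2 * ∑ i, fderiv ℝ η x₁ (stdVec i) * fderiv ℝ (fun y => fderiv ℝ v y (stdVec i)) x₁ e
      + fderiv ℝ v x₁ e * lap η x₁ ≤ 0 := by
  by_contra! hH
  set Φ : (𝔼 n) → ℝ → ℝ := fun x s => η x * lap v (x + s • e)
      + 2 * ∑ i, fderiv ℝ η x (stdVec i) * fderiv ℝ v (x + s • e) (stdVec i)
      + v (x + s • e) * lap η x with hΦ
  set Φ' : (𝔼 n) → ℝ → ℝ := fun x s => η x * fderiv ℝ (lap v) (x + s • e) e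
      + 2 * ∑ i, fderiv ℝ η x (stdVec i) *
          fderiv ℝ (fun y => fderiv ℝ v y (stdVec i)) (x + s • e) e
      + fderiv ℝ v (x + s • e) e * lap η x with hΦ'
  have hv1 : Differentiable ℝ v := hv.differentiable (by norm_num)
  have hline : ∀ (x : 𝔼 n) (s : ℝ), HasDerivAt (fun s : ℝ => x + s • e) e s := fun x s => by
    simpa using ((hasDerivAt_id s).smul_const e).const_add x
  have hcomp : ∀ {h : (𝔼 n) → ℝ}, Differentiable ℝ h → ∀ x s,
      HasDerivAt (fun s : ℝ => h (x + s • e)) (fderiv ℝ h (x + s • e) e) s :=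
    fun hh x s => (hh _).hasFDerivAt.comp_hasDerivAt s (hline x s)
  have hderiv : ∀ x s, HasDerivAt (Φ x) (Φ' x s) s := by
    intro x s
    have h1 := (hcomp (hlap.differentiable (by norm_num)) x s).const_mul (η x)
    have h2 := (HasDerivAt.fun_sum (u := Finset.univ) fun i _ =>
      (hcomp (differentiable_fderiv_apply hv (stdVec i)) x s).const_mul
        (fderiv ℝ η x (stdVec i))).const_mul 2
    have h3 := (hcomp hv1 x s).mul_const (lap η x)
    exact (h1.fun_add h2).fun_add h3
  have hshift : Continuous fun z : (𝔼 n) × ℝ => z.1 + z.2 • e := by fun_prop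
  have cfd : Continuous (fderiv ℝ v) := hv.continuous_fderiv (by norm_num)
  have hΦ'cont : Continuous fun z : (𝔼 n) × ℝ => Φ' z.1 z.2 := by
    have a1 : Continuous fun z : (𝔼 n) × ℝ => fderiv ℝ (lap v) (z.1 + z.2 • e) e :=
      ((hlap.continuous_fderiv (by norm_num)).comp hshift).clm_apply continuous_const
    have a2 : ∀ i, Continuous fun z : (𝔼 n) × ℝ => fderiv ℝ η z.1 (stdVec i) *
        fderiv ℝ (fun y => fderiv ℝ v y (stdVec i)) (z.1 + z.2 • e) e := fun i =>
      (((hη.continuous_fderiv (by norm_num)).comp continuous_fst).clm_apply continuous_const).mul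
        ((((contDiff_fderiv_apply hv _).continuous_fderiv (by norm_num)).comp hshift).clm_apply
          continuous_const)
    have a3 : Continuous fun z : (𝔼 n) × ℝ => fderiv ℝ v (z.1 + z.2 • e) e :=
      (cfd.comp hshift).clm_apply continuous_const
    exact (((hη.continuous.comp continuous_fst).mul a1).add
      ((continuous_finsetSum _ fun i _ => a2 i).const_mul 2)).add
      (a3.mul ((continuous_lap hη).comp continuous_fst))
  set H := Φ' x₁ 0 with hHdef
  have hHpos : 0 < H := by simpa [hHdef, hΦ'] using hH
  have hnear : ∀ᶠ z : (𝔼 n) × ℝ in 𝓝 (x₁, 0), H / 2 < Φ' z.1 z.2 :=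
    hΦ'cont.continuousAt.eventually_const_lt (half_lt_self hHpos)
  obtain ⟨r₁, hr₁, hball⟩ := Metric.eventually_nhds_iff.1 hnear
  obtain ⟨r₂, hr₂, hmaxball⟩ := Metric.eventually_nhds_iff.1 hmax
  obtain ⟨r, hr, hrr₁, hrr₂⟩ : ∃ r, 0 < r ∧ r < r₁ ∧ r < r₂ :=
    ⟨min r₁ r₂ / 2, by positivity, by
      have := min_le_left r₁ r₂; have : 0 < min r₁ r₂ := lt_min hr₁ hr₂; linarith, by
      have := min_le_right r₁ r₂; have : 0 < min r₁ r₂ := lt_min hr₁ hr₂; linarith⟩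
  set ε := H / 2 / (2 * n + 1) with hε
  have hεpos : 0 < ε := by positivity
  have hεn : 2 * n * ε < H / 2 := by
    rw [hε, mul_div_assoc', div_lt_iff₀ (by positivity)]
    nlinarith
  -- uniform closeness of `∂ₑv (x + s e)` to `∂ₑv x`
  have hW : Continuous fun z : ℝ × (𝔼 n) => η z.2 * fderiv ℝ v (z.2 + z.1 • e) e
      - η z.2 * fderiv ℝ v z.2 e := by
    have b1 : Continuous fun z : ℝ × (𝔼 n) => fderiv ℝ v (z.2 + z.1 • e) e :=
      (cfd.comp (by fun_prop)).clm_apply continuous_const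
    have b2 : Continuous fun z : ℝ × (𝔼 n) => fderiv ℝ v z.2 e :=
      (cfd.comp continuous_snd).clm_apply continuous_const
    have b3 : Continuous fun z : ℝ × (𝔼 n) => η z.2 := hη.continuous.comp continuous_snd
    exact (b3.mul b1).sub (b3.mul b2)
  have hunif : ∀ᶠ s : ℝ in 𝓝 0, ∀ x ∈ Metric.closedBall x₁ r,
      |η x * fderiv ℝ v (x + s • e) e - η x * fderiv ℝ v x e| < ε * r ^ 2 / 3 := by
    refine (isCompact_closedBall x₁ r).eventually_forall_of_forall_eventually fun x _ => ?_
    refine (hW.abs.continuousAt (x := ((0 : ℝ), x))).eventually_lt_const ?_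
    simpa using by positivity
  obtain ⟨s₀, hs₀, hsmall⟩ := Metric.eventually_nhds_iff.1 hunif
  set t := min s₀ r₁ / 2 with ht
  have htpos : 0 < t := by have := lt_min hs₀ hr₁; positivity
  have htmin : t < min s₀ r₁ := by linarith
  have hts : t < s₀ := htmin.trans_le (min_le_left _ _)
  have htr : t < r₁ := htmin.trans_le (min_le_right _ _)
  set f : (𝔼 n) → ℝ := fun x => η x * (v (x + t • e) - v x) - t * ε * ‖x - x₁‖ ^ 2 with hf
  have hvt : ContDiff ℝ 2 fun x => v (x + t • e) := hv.comp (contDiff_id.add contDiff_const)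
  have hηv : ContDiff ℝ 2 fun x => η x * (v (x + t • e) - v x) := hη.mul (hvt.sub hv)
  have hsq := contDiff_norm_sub_sq x₁
  have hfC : ContDiff ℝ 2 f := hηv.sub (contDiff_const.mul hsq)
  -- the Laplacian of `f` is positive on the ball
  have hlapf : ∀ x ∈ Metric.closedBall x₁ r, 0 < lap f x := by
    intro x hx
    obtain ⟨θ, hθ, hθeq⟩ := exists_hasDerivAt_eq_slope (Φ x) (Φ' x) htpos
      (fun s _ => (hderiv x s).continuousAt.continuousWithinAt) (fun s _ => hderiv x s)
    have hlow : H / 2 < Φ' x θ := by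
      refine hball (y := (x, θ)) ?_
      rw [Prod.dist_eq, max_lt_iff]
      refine ⟨(Metric.mem_closedBall.1 hx).trans_lt hrr₁, ?_⟩
      rw [Real.dist_eq, sub_zero, abs_of_pos hθ.1]
      exact hθ.2.trans htr
    rw [hθeq, sub_zero, lt_div_iff₀ htpos] at hlow
    have hcalc : lap f x = Φ x t - Φ x 0 - t * ε * (2 * n) := by
      rw [hf, lap_sub hηv (contDiff_const.mul hsq), lap_const_mul hsq, lap_norm_sub_sq,
        lap_mul hη (hvt.sub hv), lap_sub hvt hv, lap_comp_add_right]
      have hfd : ∀ i, fderiv ℝ (fun x => v (x + t • e) - v x) x (stdVec i) =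
          fderiv ℝ v (x + t • e) (stdVec i) - fderiv ℝ v x (stdVec i) := by
        intro i
        rw [fderiv_fun_sub (hvt.differentiable (by norm_num) x) (hv1 x), fderiv_comp_add_right]
        rfl
      simp only [hfd, hΦ, zero_smul, add_zero, mul_sub, Finset.sum_sub_distrib]
      ring
    rw [hcalc]
    nlinarith
  -- `f` is larger at the centre than on the boundary of the ball
  have hval : ∀ x ∈ Metric.closedBall x₁ r,
      |η x * (v (x + t • e) - v x) - t * (η x * fderiv ℝ v x e)| < t * (ε * r ^ 2 / 3) := by
    intro x hx
    obtain ⟨θ, hθ, hθeq⟩ := exists_hasDerivAt_eq_slope (fun s : ℝ => v (x + s • e))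
      (fun s => fderiv ℝ v (x + s • e) e) htpos
      (fun s _ => (hcomp hv1 x s).continuousAt.continuousWithinAt) (fun s _ => hcomp hv1 x s)
    have hb := hsmall (y := θ) (by
      rw [Real.dist_eq, sub_zero, abs_of_pos hθ.1]; exact hθ.2.trans hts) x hx
    have hb' := mul_lt_mul_of_pos_left hb htpos
    rw [← abs_of_pos htpos, ← abs_mul, abs_of_pos htpos] at hb'
    have heq : η x * (v (x + t • e) - v x) - t * (η x * fderiv ℝ v x e) =
        t * (η x * fderiv ℝ v (x + θ • e) e - η x * fderiv ℝ v x e) := by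
      rw [hθeq, zero_smul, add_zero, sub_zero]
      field_simp
    rwa [heq]
  have hx₁mem : x₁ ∈ Metric.closedBall x₁ r := Metric.mem_closedBall_self hr.le
  obtain ⟨z, hz, hzmax⟩ := (isCompact_closedBall x₁ r).exists_isMaxOn ⟨x₁, hx₁mem⟩
    hfC.continuous.continuousOn
  have hzint : z ∈ Metric.ball x₁ r := by
    by_contra hnot
    have hzr : ‖z - x₁‖ = r := by
      rw [← dist_eq_norm]
      exact le_antisymm hz (not_lt.1 hnot)
    have c1 := abs_lt.1 (hval z hz)
    have c2 := abs_lt.1 (hval x₁ hx₁mem)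
    have c3 : f x₁ ≤ f z := hzmax hx₁mem
    have c4 : η z * fderiv ℝ v z e ≤ η x₁ * fderiv ℝ v x₁ e :=
      hmaxball (y := z) ((Metric.mem_closedBall.1 hz).trans_lt hrr₂)
    have c5 := mul_le_mul_of_nonneg_left c4 htpos.le
    simp only [hf, hzr, sub_self, norm_zero] at c3
    have c6 : 0 < t * (ε * r ^ 2) := by positivity
    nlinarith [c1.2, c2.1]
  have hloc : IsLocalMax f z :=
    (hzmax.on_subset Metric.ball_subset_closedBall).isLocalMax (Metric.isOpen_ball.mem_nhds hzint)
  exact absurd (lap_nonpos_of_isLocalMax hfC hloc) (not_le.2 (hlapf z hz))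

theorem hasDerivAt_max_zero_sq (t : ℝ) : HasDerivAt (fun t : ℝ => max 0 t ^ 2) (2 * max 0 t) t := by
  rcases lt_trichotomy t 0 with ht | rfl | ht
  · rw [max_eq_left ht.le, mul_zero]
    refine (hasDerivAt_const t (0 : ℝ)).congr_of_eventuallyEq ?_
    filter_upwards [gt_mem_nhds ht] with s hs
    simp [max_eq_left (le_of_lt hs)]
  · rw [hasDerivAt_iff_tendsto_slope]
    have h : Tendsto (fun t : ℝ => max 0 t) (𝓝[≠] 0) (𝓝 (2 * max 0 0)) := by
      have : Continuous fun t : ℝ => max 0 t := by fun_prop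
      simpa using (this.tendsto 0).mono_left nhdsWithin_le_nhds
    refine h.congr' ?_
    filter_upwards [self_mem_nhdsWithin] with s hs
    rw [slope_def_field]
    rcases le_total s 0 with h0 | h0
    · simp [max_eq_left h0]
    · have : s ≠ 0 := hs
      rw [max_eq_right h0]
      field_simp
      simp [pow_two]
  · rw [max_eq_right ht.le]
    have h := hasDerivAt_pow 2 t
    simp only [Nat.cast_ofNat, Nat.add_one_sub_one, pow_one] at h
    refine h.congr_of_eventuallyEq ?_
    filter_upwards [lt_mem_nhds ht] with s hs
    simp [max_eq_right (le_of_lt hs)]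

/-- The averaging kernel `(1 - |z|²)₊`. -/
noncomputable def kernel (z : 𝔼 n) : ℝ := max 0 (1 - ‖z‖ ^ 2)

theorem kernel_nonneg (z : 𝔼 n) : 0 ≤ kernel z := le_max_left _ _

theorem continuous_kernel : Continuous (kernel (n := n)) := by
  unfold kernel
  fun_prop

theorem kernel_eq_zero {z : 𝔼 n} (hz : 1 ≤ ‖z‖) : kernel z = 0 :=
  max_eq_left (by nlinarith)

theorem hasCompactSupport_kernel : HasCompactSupport (kernel (n := n)) :=
  HasCompactSupport.intro (isCompact_closedBall 0 1) fun z hz => kernel_eq_zero (by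
    simpa using (not_le.1 (by simpa using hz)).le)

theorem integrable_mul_kernel {g : (𝔼 n) → ℝ} (hg : Continuous g) :
    Integrable fun z => g z * kernel z :=
  (hg.mul continuous_kernel).integrable_of_hasCompactSupport hasCompactSupport_kernel.mul_left

theorem integral_kernel_pos : 0 < ∫ z : 𝔼 n, kernel z :=
  continuous_kernel.integral_pos_of_hasCompactSupport_nonneg_nonzero hasCompactSupport_kernel
    kernel_nonneg (x := 0) (by simp [kernel])

theorem hasFDerivAt_kernel_sq (z : 𝔼 n) :
    HasFDerivAt (fun z : 𝔼 n => kernel z ^ 2) ((-4 * kernel z) • innerSL ℝ z) z := by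
  have h1 : HasFDerivAt (fun z : 𝔼 n => 1 - ‖z‖ ^ 2) (-(2 • innerSL ℝ z)) z := by
    simpa using (hasStrictFDerivAt_norm_sq z).hasFDerivAt.const_sub 1
  have h2 := (hasDerivAt_max_zero_sq (1 - ‖z‖ ^ 2)).comp_hasFDerivAt z h1
  refine h2.congr_fderiv (ContinuousLinearMap.ext fun a => ?_)
  change 2 * kernel z * -(2 • inner ℝ z a) = -4 * kernel z * inner ℝ z a
  rw [nsmul_eq_mul]
  push_cast
  ring

theorem fderiv_apply_eq_sum (f : (𝔼 n) → ℝ) (x z : 𝔼 n) :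
    fderiv ℝ f x z = ∑ i, fderiv ℝ f x (stdVec i) * z i := by
  rw [← inner_gradient, PiLp.inner_apply]
  simp [gradient_apply, mul_comm]

theorem integral_fderiv_mul_kernel {f : (𝔼 n) → ℝ} (hf : ContDiff ℝ 2 f) (c : 𝔼 n) (r : ℝ) :
    ∫ z, fderiv ℝ f (c + r • z) z * kernel z = r / 4 * ∫ z, lap f (c + r • z) * kernel z ^ 2 := by
  have hshift : Continuous fun z : 𝔼 n => c + r • z := by fun_prop
  have hcd : ContDiff ℝ 1 fun z : 𝔼 n => c + r • z := by fun_prop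
  have hfi : ∀ i : Fin n, Continuous fun z : 𝔼 n => fderiv ℝ f (c + r • z) (stdVec i) := fun i =>
    (contDiff_fderiv_apply hf _).continuous.comp hshift
  have hfii : ∀ i : Fin n, Continuous fun z : 𝔼 n =>
      fderiv ℝ (fun y => fderiv ℝ f y (stdVec i)) (c + r • z) (stdVec i) := fun i =>
    (((contDiff_fderiv_apply hf _).continuous_fderiv (by norm_num)).comp hshift).clm_apply
      continuous_const
  have hint : ∀ {g : (𝔼 n) → ℝ}, Continuous g → Integrable fun z => g z * kernel z ^ 2 := by
    intro g hg
    simpa [pow_two, mul_assoc] using integrable_mul_kernel (hg.mul continuous_kernel)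
  have hΨ : ∀ (z : 𝔼 n) (i : Fin n), fderiv ℝ (fun z : 𝔼 n => kernel z ^ 2) z (stdVec i) =
      -4 * (z i * kernel z) := by
    intro z i
    rw [(hasFDerivAt_kernel_sq z).fderiv]
    simp [EuclideanSpace.inner_single_right]
    ring
  have hparts : ∀ i : Fin n, ∫ z, fderiv ℝ f (c + r • z) (stdVec i) * (z i * kernel z) =
      r / 4 * ∫ z, fderiv ℝ (fun y => fderiv ℝ f y (stdVec i)) (c + r • z) (stdVec i)
        * kernel z ^ 2 := by
    intro i
    have hd := differentiable_fderiv_apply hf (stdVec i)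
    have hfd : ∀ z, fderiv ℝ (fun z => fderiv ℝ f (c + r • z) (stdVec i)) z (stdVec i) =
        r * fderiv ℝ (fun y => fderiv ℝ f y (stdVec i)) (c + r • z) (stdVec i) := fun z =>
      fderiv_comp_add_smul hd c r z (stdVec i)
    have key := integral_mul_fderiv_eq_neg_fderiv_mul_of_integrable (μ := (volume : Measure (𝔼 n)))
      (f := fun z => fderiv ℝ f (c + r • z) (stdVec i)) (g := fun z : 𝔼 n => kernel z ^ 2)
      (v := stdVec i) (by
        simp only [hfd]
        exact hint ((hfii i).const_mul r)) (by
        simp only [hΨ]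
        have : Continuous fun z : 𝔼 n => fderiv ℝ f (c + r • z) (stdVec i) * (-4 * z i) :=
          (hfi i).mul (by fun_prop)
        refine (integrable_mul_kernel this).congr (ae_of_all _ fun z => ?_)
        ring) (hint (hfi i))
      (fun z _ => (hd.comp (hcd.differentiable (by norm_num))) z)
      (fun z _ => (hasFDerivAt_kernel_sq z).differentiableAt)
    simp only [hfd, hΨ, mul_assoc, mul_left_comm _ (-4 : ℝ), integral_const_mul] at key
    linarith
  have hL : ∀ z : 𝔼 n, fderiv ℝ f (c + r • z) z * kernel z =
      ∑ i, fderiv ℝ f (c + r • z) (stdVec i) * (z i * kernel z) := by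
    intro z
    rw [fderiv_apply_eq_sum, Finset.sum_mul]
    simp only [mul_assoc]
  have hR : ∀ z : 𝔼 n, lap f (c + r • z) * kernel z ^ 2 =
      ∑ i, fderiv ℝ (fun y => fderiv ℝ f y (stdVec i)) (c + r • z) (stdVec i) * kernel z ^ 2 := by
    intro z
    rw [lap, Finset.sum_mul]
  simp only [hL, hR]
  rw [integral_finsetSum, integral_finsetSum, Finset.mul_sum]
  · exact Finset.sum_congr rfl fun i _ => hparts i
  · exact fun i _ => hint (hfii i)
  · intro i _
    have : Continuous fun z : 𝔼 n => fderiv ℝ f (c + r • z) (stdVec i) * z i :=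
      (hfi i).mul (by fun_prop)
    simpa only [mul_assoc] using integrable_mul_kernel this

theorem hasDerivAt_integral_mul_kernel {f : (𝔼 n) → ℝ} (hf : ContDiff ℝ 2 f) (c : 𝔼 n) (r : ℝ) :
    HasDerivAt (fun r : ℝ => ∫ z, f (c + r • z) * kernel z)
      (∫ z, fderiv ℝ f (c + r • z) z * kernel z) r := by
  have cfd : Continuous (fderiv ℝ f) := hf.continuous_fderiv (by norm_num)
  have hcont : Continuous fun w : ℝ × (𝔼 n) => fderiv ℝ f (c + w.1 • w.2) w.2 :=
    (cfd.comp (by fun_prop)).clm_apply continuous_snd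
  obtain ⟨C, hC⟩ := ((isCompact_closedBall r 1).prod
    (isCompact_closedBall (0 : 𝔼 n) 1)).exists_bound_of_continuousOn hcont.continuousOn
  have hF : ∀ s : ℝ, Continuous fun z : 𝔼 n => f (c + s • z) := fun s =>
    hf.continuous.comp (by fun_prop)
  have hF' : Continuous fun z : 𝔼 n => fderiv ℝ f (c + r • z) z :=
    hcont.comp (by fun_prop : Continuous fun z : 𝔼 n => (r, z))
  refine (hasDerivAt_integral_of_dominated_loc_of_deriv_le (μ := (volume : Measure (𝔼 n)))
    (F := fun (s : ℝ) z => f (c + s • z) * kernel z)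
    (F' := fun (s : ℝ) z => fderiv ℝ f (c + s • z) z * kernel z)
    (bound := fun z => C * kernel z) (Metric.closedBall_mem_nhds r one_pos)
    (Eventually.of_forall fun s => (integrable_mul_kernel (hF s)).aestronglyMeasurable)
    (integrable_mul_kernel (hF r)) (integrable_mul_kernel hF').aestronglyMeasurable
    (ae_of_all _ fun z s hs => ?_) (integrable_mul_kernel continuous_const)
    (ae_of_all _ fun z s _ => ?_)).2
  · by_cases hz : ‖z‖ ≤ 1
    · rw [norm_mul, Real.norm_of_nonneg (kernel_nonneg z)]
      exact mul_le_mul_of_nonneg_right (hC (s, z) ⟨hs, by simpa using hz⟩) (kernel_nonneg z)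
    · simp [kernel_eq_zero (not_le.1 hz).le]
  · have hline : HasDerivAt (fun s : ℝ => c + s • z) z s := by
      simpa using ((hasDerivAt_id s).smul_const z).const_add c
    exact ((hf.differentiable (by norm_num) _).hasFDerivAt.comp_hasDerivAt s hline).mul_const _

/-- Sub-mean value inequality for `C²` subharmonic functions. -/
theorem mul_integral_kernel_le {f : (𝔼 n) → ℝ} (hf : ContDiff ℝ 2 f) (hlap : ∀ x, 0 ≤ lap f x)
    (c : 𝔼 n) {r : ℝ} (hr : 0 ≤ r) :
    f c * ∫ z : 𝔼 n, kernel z ≤ ∫ z, f (c + r • z) * kernel z := by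
  have hmono : MonotoneOn (fun r : ℝ => ∫ z, f (c + r • z) * kernel z) (Ici 0) := by
    refine monotoneOn_of_deriv_nonneg (convex_Ici 0)
      (fun s _ => (hasDerivAt_integral_mul_kernel hf c s).continuousAt.continuousWithinAt)
      (fun s _ => (hasDerivAt_integral_mul_kernel hf c s).differentiableAt.differentiableWithinAt)
      fun s hs => ?_
    rw [interior_Ici] at hs
    rw [(hasDerivAt_integral_mul_kernel hf c s).deriv, integral_fderiv_mul_kernel hf]
    have : 0 ≤ ∫ z, lap f (c + s • z) * kernel z ^ 2 :=
      integral_nonneg fun z => mul_nonneg (hlap _) (sq_nonneg _)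
    have : (0 : ℝ) < s := hs
    positivity
  have := hmono (mem_Ici.2 le_rfl) (mem_Ici.2 hr) hr
  simpa [integral_const_mul] using this

theorem kernel_two_smul_add_le (z : 𝔼 n) {a : 𝔼 n} (ha : ‖a‖ ≤ 1 / 2) :
    kernel ((2 : ℝ) • z + a) ≤ 16 / 7 * kernel z := by
  rcases le_total 1 ‖(2 : ℝ) • z + a‖ with h | h
  · rw [kernel_eq_zero h]
    have := kernel_nonneg z
    positivity
  · have h1 : kernel ((2 : ℝ) • z + a) ≤ 1 := max_le zero_le_one (by nlinarith [sq_nonneg ‖(2 : ℝ) • z + a‖])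
    have h2 : 2 * ‖z‖ ≤ 3 / 2 := by
      calc 2 * ‖z‖ = ‖((2 : ℝ) • z + a) - a‖ := by simp [norm_smul]
        _ ≤ ‖(2 : ℝ) • z + a‖ + ‖a‖ := norm_sub_le _ _
        _ ≤ 3 / 2 := by linarith
    have h3 : 1 - ‖z‖ ^ 2 ≤ kernel z := le_max_right _ _
    nlinarith [norm_nonneg z]

theorem rpow_sub_rpow_le {m I t M : ℝ} (hm : 1 ≤ m) (hI : 0 ≤ I) (ht : 0 < t)
    (hIt : I ≤ t) (htM : t ≤ M) : t ^ m - I ^ m ≤ m * M ^ (m - 1) * (t - I) := by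
  have hB := one_add_mul_self_le_rpow_one_add (s := I / t - 1)
    (by linarith [div_nonneg hI ht.le]) hm
  rw [add_sub_cancel, Real.div_rpow hI ht.le, le_div_iff₀ (Real.rpow_pos_of_pos ht m)] at hB
  have h1 : t ^ m = t ^ (m - 1) * t := by
    rw [← Real.rpow_add_one ht.ne', sub_add_cancel]
  have h2 : t ^ m - I ^ m ≤ m * t ^ (m - 1) * (t - I) := by
    have : (1 + m * (I / t - 1)) * t ^ m = t ^ m + m * t ^ (m - 1) * (I - t) := by
      rw [h1]
      field_simp
    linarith
  have h3 : t ^ (m - 1) ≤ M ^ (m - 1) := Real.rpow_le_rpow ht.le htM (by linarith)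
  refine h2.trans (mul_le_mul_of_nonneg_right ?_ (by linarith))
  exact mul_le_mul_of_nonneg_left h3 (by linarith)

/-- A bounded positive superharmonic function, some power of which is subharmonic, is constant. -/
theorem eq_of_lap_nonpos_of_lap_rpow_nonneg {u : (𝔼 n) → ℝ} (hu : ContDiff ℝ 2 u)
    (hpos : ∀ x, 0 < u x) {M : ℝ} (hM : ∀ x, u x ≤ M) (hsuper : ∀ x, lap u x ≤ 0) {m : ℝ}
    (hm : 1 ≤ m) (hsub : ∀ x, 0 ≤ lap (fun y => u y ^ m) x) (x y : 𝔼 n) : u x = u y := by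
  set I := ⨅ x, u x with hIdef
  have hbdd : BddBelow (range u) := ⟨0, by rintro _ ⟨x, rfl⟩; exact (hpos x).le⟩
  have hI0 : 0 ≤ I := le_ciInf fun x => (hpos x).le
  have hIu : ∀ x, I ≤ u x := fun x => ciInf_le hbdd x
  have hκ : 0 < ∫ z : 𝔼 n, kernel z := integral_kernel_pos
  set L := m * M ^ (m - 1) with hL
  have hM0 : 0 < M := (hpos 0).trans_le (hM 0)
  have hL0 : 0 < L := by positivity
  have hum : ContDiff ℝ 2 fun y => u y ^ m := hu.rpow_const_of_ne fun x => (hpos x).ne'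
  have hcu := hu.continuous
  have hcum := hum.continuous
  have key : ∀ x₀ y, u y ^ m - I ^ m ≤ 2 ^ n * (16 / 7) * L * (u x₀ - I) := by
    intro x₀ y
    set R := 2 * ‖x₀ - y‖ + 1 with hR
    have hRpos : 0 < R := by positivity
    have s1 : (u y ^ m - I ^ m) * ∫ z : 𝔼 n, kernel z ≤
        ∫ z, (u (y + R • z) ^ m - I ^ m) * kernel z := by
      have := mul_integral_kernel_le hum hsub y hRpos.le
      simp only [sub_mul]
      rw [integral_sub, integral_const_mul]
      · linarith
      · exact integrable_mul_kernel (hcum.comp (by fun_prop : Continuous fun z : 𝔼 n => y + R • z))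
      · exact integrable_mul_kernel continuous_const
    set a := R⁻¹ • (x₀ - y) with ha
    have hanorm : ‖a‖ ≤ 1 / 2 := by
      rw [ha, norm_smul, norm_inv, Real.norm_of_nonneg hRpos.le, inv_mul_le_iff₀ hRpos]
      linarith
    have harg : ∀ z : 𝔼 n, y + R • ((2 : ℝ) • z + a) = x₀ + (2 * R) • z := by
      intro z
      rw [ha, smul_add, smul_inv_smul₀ hRpos.ne', smul_smul, mul_comm R 2]
      abel
    have s2 : ∫ z, (u (y + R • z) ^ m - I ^ m) * kernel z = 2 ^ n *
        ∫ z : 𝔼 n, (u (x₀ + (2 * R) • z) ^ m - I ^ m) * kernel ((2 : ℝ) • z + a) := by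
      have e1 := Measure.integral_comp_smul_of_nonneg (volume : Measure (𝔼 n))
        (fun z => (u (y + R • (z + a)) ^ m - I ^ m) * kernel (z + a)) 2 (hR := by norm_num)
      have e2 := integral_add_right_eq_self (μ := (volume : Measure (𝔼 n)))
        (fun z => (u (y + R • z) ^ m - I ^ m) * kernel z) a
      simp only [harg] at e1
      rw [e1, e2]
      simp
    have hG : ∀ x, u x ^ m - I ^ m ≤ L * (u x - I) := fun x =>
      rpow_sub_rpow_le hm hI0 (hpos x) (hIu x) (hM x)
    have hG0 : ∀ x, 0 ≤ u x ^ m - I ^ m := fun x =>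
      sub_nonneg.2 (Real.rpow_le_rpow hI0 (hIu x) (by linarith))
    have hcx : Continuous fun z : 𝔼 n => x₀ + (2 * R) • z := by fun_prop
    have hint : Integrable fun z : 𝔼 n => (u (x₀ + (2 * R) • z) - I) * kernel z :=
      integrable_mul_kernel ((hcu.comp hcx).sub continuous_const)
    have s3 : ∫ z : 𝔼 n, (u (x₀ + (2 * R) • z) ^ m - I ^ m) * kernel ((2 : ℝ) • z + a) ≤
        ∫ z : 𝔼 n, (16 / 7 * L) * ((u (x₀ + (2 * R) • z) - I) * kernel z) := by
      refine integral_mono_of_nonneg (ae_of_all _ fun z => mul_nonneg (hG0 _) (kernel_nonneg _))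
        (hint.const_mul _) (ae_of_all _ fun z => ?_)
      have := mul_le_mul (hG (x₀ + (2 * R) • z)) (kernel_two_smul_add_le z hanorm)
        (kernel_nonneg _) (mul_nonneg hL0.le (sub_nonneg.2 (hIu _)))
      refine this.trans_eq ?_
      ring
    have s4 : ∫ z : 𝔼 n, (u (x₀ + (2 * R) • z) - I) * kernel z ≤
        (u x₀ - I) * ∫ z : 𝔼 n, kernel z := by
      have hneg : ContDiff ℝ 2 fun x => (-1 : ℝ) * u x := contDiff_const.mul hu
      have := mul_integral_kernel_le hneg
        (fun x => by rw [lap_const_mul hu]; linarith [hsuper x]) x₀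
        (show (0 : ℝ) ≤ 2 * R by positivity)
      simp only [mul_assoc, integral_const_mul] at this
      simp only [sub_mul]
      rw [integral_sub, integral_const_mul]
      · linarith
      · exact integrable_mul_kernel (hcu.comp hcx)
      · exact integrable_mul_kernel continuous_const
    rw [integral_const_mul] at s3
    refine le_of_mul_le_mul_right ?_ hκ
    calc (u y ^ m - I ^ m) * ∫ z : 𝔼 n, kernel z
        ≤ 2 ^ n * ((16 / 7 * L) * ((u x₀ - I) * ∫ z : 𝔼 n, kernel z)) := by
          rw [s2] at s1
          refine s1.trans (mul_le_mul_of_nonneg_left (s3.trans ?_) (by positivity))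
          exact mul_le_mul_of_nonneg_left s4 (by positivity)
      _ = _ := by ring
  have heqI : ∀ y, u y = I := by
    intro y
    refine le_antisymm ?_ (hIu y)
    have hle : u y ^ m - I ^ m ≤ 0 := by
      refine le_of_forall_pos_le_add fun δ hδ => ?_
      set C := 2 ^ n * (16 / 7) * L with hC
      have hC0 : 0 < C := by positivity
      obtain ⟨x₀, hx₀⟩ := exists_lt_of_ciInf_lt (f := u) (a := I + δ / C)
        (lt_add_of_pos_right _ (by positivity))
      have h1 := key x₀ y
      have h2 : C * (u x₀ - I) ≤ C * (δ / C) := mul_le_mul_of_nonneg_left (by linarith) hC0.le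
      rw [mul_div_cancel₀ _ hC0.ne'] at h2
      linarith
    exact (Real.rpow_le_rpow_iff (hpos y).le hI0 (by linarith)).1 (sub_nonpos.1 hle)
  rw [heqI x, heqI y]

/-- The algebraic core of the gradient estimate: the second-order condition at a maximum of
`η |∇v|` gives a quadratic inequality for the maximal value. -/
theorem sq_le_of_second_order {η w V M D S L a b p T N : ℝ} (hη : 0 < η) (hη1 : η ≤ 1) (hw : 0 < w)
    (hV : 0 < V) (hVM : V ≤ M) (hb : 0 < b) (hp : 2 < p) (hT : 1 ≤ T) (haT : |a| ≤ b / 2 * T)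
    (hN : 0 ≤ N) (hD : |D| ≤ 4 * w ^ 2 / η) (hS : -(4 * w / η) ≤ S)
    (hL : V * L - (a * w ^ 2 + b * (T * w ^ 2)) / V * w = -((a + b * (p / 2) * T) * D))
    (hmax : η * L + 2 * S - w * (2 * N) ≤ 0) :
    (η * w) ^ 2 ≤ 8 * p * M * (η * w) + 2 / b * (8 + 2 * N) * M ^ 2 := by
  have hM : 0 < M := hV.trans_le hVM
  set G := a * w ^ 2 + b * (T * w ^ 2) with hG
  set G' := a + b * (p / 2) * T with hG'
  have hbT : 0 < b * T := by positivity
  have hGlow : b / 2 * T * w ^ 2 ≤ G := by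
    have : -(b / 2 * T) ≤ a := (abs_le.1 haT).1
    nlinarith [sq_nonneg w]
  have hG'up : |G'| ≤ b * p * T := by
    rw [abs_le]
    have := abs_le.1 haT
    constructor <;> nlinarith
  have hLeq : L * V ^ 2 = G * w - G' * D * V := by
    have : V * (V * L - G / V * w) = V * -(G' * D) := by rw [hL]
    field_simp at this
    linarith
  have hηD : η * |D| ≤ 4 * w ^ 2 := by
    rw [le_div_iff₀ hη] at hD
    linarith
  have hηS : -(4 * w) ≤ η * S := by
    have := mul_le_mul_of_nonneg_left hS hη.le
    rwa [mul_neg, mul_div_cancel₀ _ hη.ne'] at this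
  have hGD : η * (G' * D) ≤ b * p * T * (4 * w ^ 2) := by
    calc η * (G' * D) ≤ η * |G' * D| := mul_le_mul_of_nonneg_left (le_abs_self _) hη.le
      _ = |G'| * (η * |D|) := by rw [abs_mul]; ring
      _ ≤ _ := mul_le_mul hG'up hηD (by positivity) (by positivity)
  have hmul : η * V ^ 2 * (η * L + 2 * S - w * (2 * N)) ≤ 0 :=
    mul_nonpos_of_nonneg_of_nonpos (by positivity) hmax
  have hV2 : V ^ 2 ≤ M ^ 2 := pow_le_pow_left₀ hV.le hVM 2
  have h1 : η ^ 2 * (G * w) ≤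
      η * V * (b * p * T * (4 * w ^ 2)) + V ^ 2 * (8 * w) + V ^ 2 * (2 * N * w) := by
    have e1 : η ^ 2 * (L * V ^ 2) + 2 * V ^ 2 * (η * S) - η * V ^ 2 * (2 * N * w) ≤ 0 := by
      linarith
    rw [hLeq] at e1
    have e2 : η * V * (η * (G' * D)) ≤ η * V * (b * p * T * (4 * w ^ 2)) :=
      mul_le_mul_of_nonneg_left hGD (by positivity)
    have e3 := mul_le_mul_of_nonneg_left hηS (show 0 ≤ 2 * V ^ 2 by positivity)
    have e4 : η * (V ^ 2 * (2 * N * w)) ≤ 1 * (V ^ 2 * (2 * N * w)) :=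
      mul_le_mul_of_nonneg_right hη1 (by positivity)
    linarith
  have h2 : η ^ 2 * (b / 2 * T * w ^ 2) ≤
      4 * b * p * T * M * (η * w) + (8 + 2 * N) * M ^ 2 := by
    refine le_of_mul_le_mul_right ?_ hw
    calc η ^ 2 * (b / 2 * T * w ^ 2) * w ≤ η ^ 2 * (G * w) := by
          rw [mul_assoc]
          gcongr
      _ ≤ _ := h1
      _ = 4 * b * p * T * V * (η * w) * w + (8 + 2 * N) * V ^ 2 * w := by ring
      _ ≤ 4 * b * p * T * M * (η * w) * w + (8 + 2 * N) * M ^ 2 * w := by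
          gcongr
      _ = _ := by ring
  have h3 : (8 + 2 * N) * M ^ 2 ≤ T * ((8 + 2 * N) * M ^ 2) :=
    le_mul_of_one_le_left (by positivity) hT
  have h4 : (b / 2 * T) * (η * w) ^ 2 ≤
      (b / 2 * T) * (8 * p * M * (η * w) + 2 / b * (8 + 2 * N) * M ^ 2) := by
    have : (b / 2 * T) * (8 * p * M * (η * w) + 2 / b * (8 + 2 * N) * M ^ 2) =
        4 * b * p * T * M * (η * w) + T * ((8 + 2 * N) * M ^ 2) := by
      field_simp
      ring
    rw [this]
    linarith
  exact le_of_mul_le_mul_left h4 (by positivity)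

theorem le_of_sq_le {y A B : ℝ} (hA : 0 ≤ A) (hB : 0 ≤ B) (h : y ^ 2 ≤ A * y + B) :
    y ≤ A + B + 1 := by
  by_contra! hlt
  nlinarith

theorem contDiff_sum_sq_fderiv {v : (𝔼 n) → ℝ} (hv : ContDiff ℝ 2 v) :
    ContDiff ℝ 1 fun x => ∑ i, fderiv ℝ v x (stdVec i) ^ 2 :=
  ContDiff.sum fun i _ => (contDiff_fderiv_apply hv (stdVec i)).pow 2

theorem sq_rpow_half {t : ℝ} (ht : 0 ≤ t) (r : ℝ) : (t ^ 2) ^ (r / 2) = t ^ r := by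
  rw [← Real.rpow_natCast t 2, ← Real.rpow_mul ht]
  congr 1
  push_cast
  ring

/-- Bernstein-type gradient bound for positive bounded solutions of
`v Δv = -(a |∇v|² + b |∇v|ᵖ)` with `p > 2`. -/
theorem exists_norm_gradient_le {v : (𝔼 n) → ℝ} (hv : ContDiff ℝ 2 v) (hpos : ∀ x, 0 < v x)
    {M : ℝ} (hM : ∀ x, v x ≤ M) {p a b : ℝ} (hp : 2 < p) (hb : 0 < b)
    (heq : ∀ x, v x * lap v x = -(a * ‖gradient v x‖ ^ 2 + b * ‖gradient v x‖ ^ p)) :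
    ∃ K, ∀ x, ‖gradient v x‖ ≤ K := by
  have hM0 : 0 < M := (hpos 0).trans_le (hM 0)
  set W := max 1 ((2 * |a| / b) ^ (1 / (p - 2))) with hW
  set A := 8 * p * M with hA
  set B := 2 / b * (8 + 2 * (n : ℝ)) * M ^ 2 with hB
  have hA0 : 0 ≤ A := by positivity
  have hB0 : 0 ≤ B := by positivity
  set P : (𝔼 n) → ℝ := fun x => ∑ i, fderiv ℝ v x (stdVec i) ^ 2 with hP
  have hPsq : ∀ x, P x = ‖gradient v x‖ ^ 2 := fun x => (norm_gradient_sq v x).symm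
  have hPC : ContDiff ℝ 1 P := contDiff_sum_sq_fderiv hv
  have hPp : ContDiff ℝ 1 fun x => P x ^ (p / 2) := by
    have h := Real.contDiff_rpow_const_of_le (p := p / 2) (n := 1) (by push_cast; linarith)
    exact h.comp hPC
  have heqP : ∀ x, v x * lap v x = -(a * P x + b * P x ^ (p / 2)) := by
    intro x
    rw [heq, hPsq, sq_rpow_half (norm_nonneg _)]
  have hlapC : ContDiff ℝ 1 (lap v) := by
    have hform : lap v = fun x => -(a * P x + b * P x ^ (p / 2)) / v x := by
      funext x
      rw [eq_div_iff (hpos x).ne', mul_comm]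
      exact heqP x
    rw [hform]
    exact ((contDiff_const.mul hPC).add (contDiff_const.mul hPp)).neg.div
      (hv.of_le (by norm_num)) fun x => (hpos x).ne'
  have hv1 : Differentiable ℝ v := hv.differentiable (by norm_num)
  refine ⟨max W (A + B + 1), fun x₀ => ?_⟩
  set η : (𝔼 n) → ℝ := fun x => 1 - ‖x - x₀‖ ^ 2 with hη
  have hηC : ContDiff ℝ 2 η := contDiff_const.sub (contDiff_norm_sub_sq x₀)
  have hηfd : ∀ x c, fderiv ℝ η x c = -(2 * inner ℝ (x - x₀) c) := by
    intro x c
    rw [hη, fderiv_const_sub]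
    change -(fderiv ℝ (fun y : 𝔼 n => ‖y - x₀‖ ^ 2) x c) = _
    rw [fderiv_norm_sub_sq]
  have hηlap : ∀ x, lap η x = -(2 * n) := by
    intro x
    rw [hη, lap_sub contDiff_const (contDiff_norm_sub_sq x₀), lap_norm_sub_sq]
    simp [lap]
  have hgc : Continuous fun x => ‖gradient v x‖ := by
    simp only [norm_gradient_eq]
    exact (hv.continuous_fderiv (by norm_num)).norm
  obtain ⟨x₁, hx₁, hmax⟩ := (isCompact_closedBall x₀ 1).exists_isMaxOn
    ⟨x₀, Metric.mem_closedBall_self zero_le_one⟩ (hηC.continuous.mul hgc).continuousOn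
  have hcenter : ‖gradient v x₀‖ ≤ η x₁ * ‖gradient v x₁‖ := by
    have := hmax (Metric.mem_closedBall_self (x := x₀) zero_le_one)
    simpa [hη] using this
  refine hcenter.trans ?_
  set w := ‖gradient v x₁‖ with hw
  have hη1 : η x₁ ≤ 1 := by simp only [hη]; nlinarith [sq_nonneg ‖x₁ - x₀‖]
  rcases le_total w W with hwW | hWw
  · refine le_trans ?_ (le_max_left _ _)
    have : η x₁ * w ≤ 1 * w := mul_le_mul_of_nonneg_right hη1 (norm_nonneg _)
    linarith
  rcases le_or_gt (η x₁) 0 with hηneg | hηpos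
  · have : η x₁ * w ≤ 0 := mul_nonpos_of_nonpos_of_nonneg hηneg (norm_nonneg _)
    exact this.trans ((zero_le_one.trans (le_max_left _ _)).trans (le_max_left _ _))
  refine le_trans (le_of_sq_le hA0 hB0 ?_) (le_max_right _ _)
  have hw1 : 1 ≤ w := (le_max_left _ _).trans hWw
  have hw0 : 0 < w := zero_lt_one.trans_le hw1
  have hT1 : 1 ≤ w ^ (p - 2) := Real.one_le_rpow hw1 (by linarith)
  have haT : |a| ≤ b / 2 * w ^ (p - 2) := by
    have h1 : (2 * |a| / b) ^ (1 / (p - 2)) ≤ w := (le_max_right _ _).trans hWw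
    have h2 := Real.rpow_le_rpow (by positivity) h1 (show 0 ≤ p - 2 by linarith)
    rw [← Real.rpow_mul (by positivity), one_div_mul_cancel (by linarith), Real.rpow_one,
      div_le_iff₀ hb] at h2
    linarith
  set e : 𝔼 n := w⁻¹ • gradient v x₁ with he
  have hnorm_e : ‖e‖ = 1 := by
    rw [he, norm_smul, norm_inv, Real.norm_of_nonneg hw0.le, ← hw, inv_mul_cancel₀ hw0.ne']
  have hve : fderiv ℝ v x₁ e = w := by
    rw [← inner_gradient, he, inner_smul_right, real_inner_self_eq_norm_sq, ← hw]
    field_simp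
  have hxlt : ‖x₁ - x₀‖ < 1 := by
    simp only [hη] at hηpos
    nlinarith [norm_nonneg (x₁ - x₀)]
  have hball : Metric.ball x₀ 1 ∈ 𝓝 x₁ := Metric.isOpen_ball.mem_nhds (by
    rwa [Metric.mem_ball, dist_eq_norm])
  have hloc : IsLocalMax (fun x => η x * fderiv ℝ v x e) x₁ := by
    filter_upwards [hball] with x hx
    rw [hve]
    have hxn : ‖x - x₀‖ < 1 := by rwa [Metric.mem_ball, dist_eq_norm] at hx
    have hηx : 0 ≤ η x := by
      simp only [hη]
      nlinarith [norm_nonneg (x - x₀)]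
    have h1 : fderiv ℝ v x e ≤ ‖gradient v x‖ := by
      rw [← inner_gradient]
      simpa [hnorm_e] using real_inner_le_norm (gradient v x) e
    exact (mul_le_mul_of_nonneg_left h1 hηx).trans (hmax (Metric.ball_subset_closedBall hx))
  have hsecond := second_order_of_isLocalMax hηC hv hlapC hloc
  have hmixed : ∀ i, fderiv ℝ (fun y => fderiv ℝ v y (stdVec i)) x₁ e =
      -(w / η x₁) * fderiv ℝ η x₁ (stdVec i) := by
    intro i
    have h0 := hloc.fderiv_eq_zero
    rw [fderiv_fun_mul (hηC.differentiable (by norm_num) x₁)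
      (differentiable_fderiv_apply hv e x₁)] at h0
    have h1 : η x₁ * fderiv ℝ (fun y => fderiv ℝ v y e) x₁ (stdVec i)
        + fderiv ℝ v x₁ e * fderiv ℝ η x₁ (stdVec i) = 0 :=
      congrArg (fun ℓ : (𝔼 n) →L[ℝ] ℝ => ℓ (stdVec i)) h0
    rw [hve] at h1
    rw [fderiv_fderiv_apply_comm hv]
    field_simp
    linarith
  set S := ∑ i, fderiv ℝ η x₁ (stdVec i) * fderiv ℝ (fun y => fderiv ℝ v y (stdVec i)) x₁ e with hS
  have hSlow : -(4 * w / η x₁) ≤ S := by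
    have hsum : ∑ i, fderiv ℝ η x₁ (stdVec i) ^ 2 = 4 * ‖x₁ - x₀‖ ^ 2 := by
      rw [EuclideanSpace.norm_sq_eq, Finset.mul_sum]
      refine Finset.sum_congr rfl fun i _ => ?_
      rw [hηfd, EuclideanSpace.inner_single_right]
      simp
      ring
    have hSeq : S = -(w / η x₁) * (4 * ‖x₁ - x₀‖ ^ 2) := by
      rw [hS, ← hsum, Finset.mul_sum]
      refine Finset.sum_congr rfl fun i _ => ?_
      rw [hmixed]
      ring
    have h1 : ‖x₁ - x₀‖ ^ 2 ≤ 1 := by nlinarith [norm_nonneg (x₁ - x₀)]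
    have h2 : w / η x₁ * (4 * ‖x₁ - x₀‖ ^ 2) ≤ w / η x₁ * 4 := by
      gcongr
      linarith
    rw [hSeq, show 4 * w / η x₁ = w / η x₁ * 4 by ring]
    linarith
  set D := fderiv ℝ P x₁ e with hD
  have hDval : D = -(2 * (w / η x₁)) * fderiv ℝ η x₁ (gradient v x₁) := by
    have h1 : HasFDerivAt P (∑ i, (2 * fderiv ℝ v x₁ (stdVec i)) •
        fderiv ℝ (fun y => fderiv ℝ v y (stdVec i)) x₁) x₁ :=
      HasFDerivAt.fun_sum fun i _ => by
        simpa using (differentiable_fderiv_apply hv (stdVec i) x₁).hasFDerivAt.pow 2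
    rw [hD, h1.fderiv, sum_apply, ← sum_fderiv_mul_fderiv, Finset.mul_sum]
    refine Finset.sum_congr rfl fun i _ => ?_
    rw [smul_apply, hmixed, smul_eq_mul]
    ring
  have hDbound : |D| ≤ 4 * w ^ 2 / η x₁ := by
    have h1 : |inner ℝ (x₁ - x₀) (gradient v x₁)| ≤ 1 * w :=
      (abs_real_inner_le_norm _ _).trans (mul_le_mul_of_nonneg_right hxlt.le (norm_nonneg _))
    rw [hDval, hηfd, neg_mul_neg, abs_mul,
      abs_of_pos (show 0 < 2 * (w / η x₁) by positivity), abs_mul, abs_two]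
    calc 2 * (w / η x₁) * (2 * |inner ℝ (x₁ - x₀) (gradient v x₁)|)
        ≤ 2 * (w / η x₁) * (2 * (1 * w)) := by gcongr
      _ = _ := by ring
  have hPx₁ : P x₁ = w ^ 2 := hPsq x₁
  have hrpow : w ^ p = w ^ (p - 2) * w ^ 2 := by
    rw [← Real.rpow_natCast w 2, ← Real.rpow_add hw0]
    norm_num
  have hL : v x₁ * fderiv ℝ (lap v) x₁ e
      - (a * w ^ 2 + b * (w ^ (p - 2) * w ^ 2)) / v x₁ * w
      = -((a + b * (p / 2) * w ^ (p - 2)) * D) := by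
    have hl : HasFDerivAt (fun x => v x * lap v x)
        (v x₁ • fderiv ℝ (lap v) x₁ + lap v x₁ • fderiv ℝ v x₁) x₁ :=
      (hv1 x₁).hasFDerivAt.fun_mul (hlapC.differentiable (by norm_num) x₁).hasFDerivAt
    have hPd := (hPC.differentiable (by norm_num) x₁).hasFDerivAt
    have hr : HasFDerivAt (fun x => -(a * P x + b * P x ^ (p / 2)))
        (-(a • fderiv ℝ P x₁ + b • ((p / 2 * P x₁ ^ (p / 2 - 1)) • fderiv ℝ P x₁))) x₁ :=
      ((hPd.const_mul a).fun_add
        ((hPd.rpow_const (Or.inr (by linarith))).const_mul b)).fun_neg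
    have hl' : HasFDerivAt (fun x => -(a * P x + b * P x ^ (p / 2)))
        (v x₁ • fderiv ℝ (lap v) x₁ + lap v x₁ • fderiv ℝ v x₁) x₁ := by
      simpa only [heqP] using hl
    have h1 : v x₁ * fderiv ℝ (lap v) x₁ e + lap v x₁ * fderiv ℝ v x₁ e =
        -(a * D + b * ((p / 2 * P x₁ ^ (p / 2 - 1)) * D)) :=
      congrArg (fun ℓ : (𝔼 n) →L[ℝ] ℝ => ℓ e) (hl'.unique hr)
    have h2 : lap v x₁ = -((a * w ^ 2 + b * (w ^ (p - 2) * w ^ 2)) / v x₁) := by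
      rw [← neg_div, eq_div_iff (hpos x₁).ne', mul_comm, heq, ← hw, hrpow]
    have h3 : P x₁ ^ (p / 2 - 1) = w ^ (p - 2) := by
      rw [hPx₁, show p / 2 - 1 = (p - 2) / 2 by ring, sq_rpow_half hw0.le]
    rw [hve, h2, h3] at h1
    linarith
  refine sq_le_of_second_order hηpos hη1 hw0 (hpos x₁) (hM x₁) hb hp hT1 haT (Nat.cast_nonneg n)
    hDbound hSlow hL ?_
  rw [hve, hηlap] at hsecond
  linarith

theorem lap_rpow_nonneg {v : (𝔼 n) → ℝ} (hv : ContDiff ℝ 2 v) (hpos : ∀ x, 0 < v x) {m : ℝ}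
    (hm : 0 ≤ m) (hlap : ∀ x, -((m - 1) * ‖gradient v x‖ ^ 2) ≤ v x * lap v x) (x : 𝔼 n) :
    0 ≤ lap (fun y => v y ^ m) x := by
  have h1 : v x ^ (m - 1) = v x ^ (m - 2) * v x := by
    rw [← Real.rpow_add_one (hpos x).ne']
    ring_nf
  have h2 : lap (fun y => v y ^ m) x =
      m * v x ^ (m - 2) * (v x * lap v x + (m - 1) * ‖gradient v x‖ ^ 2) := by
    rw [lap_rpow hv hpos, h1]
    ring
  rw [h2]
  exact mul_nonneg (mul_nonneg hm (Real.rpow_nonneg (hpos x).le _)) (by linarith [hlap x])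

theorem norm_gradient_rpow {u : (𝔼 n) → ℝ} (hu : Differentiable ℝ u) (hpos : ∀ x, 0 < u x)
    {r : ℝ} (hr : 0 ≤ r) (x : 𝔼 n) :
    ‖gradient (fun y => u y ^ r) x‖ = r * u x ^ (r - 1) * ‖gradient u x‖ := by
  rw [norm_gradient_eq, (hasFDerivAt_rpow_comp hu hpos r x).fderiv, norm_smul, ← norm_gradient_eq,
    Real.norm_of_nonneg (mul_nonneg hr (Real.rpow_nonneg (hpos x).le _))]

/-- The power `v = u ^ γ` with `γ (p - 2) = p + q - 1` solves an equation that is homogeneous of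
degree zero in `v`. -/
theorem rpow_mul_lap_rpow {u : (𝔼 n) → ℝ} (hu : ContDiff ℝ 2 u) (hpos : ∀ x, 0 < u x) {p q γ : ℝ}
    (hγ : 0 < γ) (hγp : γ * (p - 2) = p + q - 1)
    (heq : ∀ x, -lap u x = u x ^ q * ‖gradient u x‖ ^ p) (x : 𝔼 n) :
    u x ^ γ * lap (fun y => u y ^ γ) x =
      -((1 - γ) / γ * ‖gradient (fun y => u y ^ γ) x‖ ^ 2
        + γ ^ (1 - p) * ‖gradient (fun y => u y ^ γ) x‖ ^ p) := by
  have hx := hpos x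
  have hlap : lap u x = -(u x ^ q * ‖gradient u x‖ ^ p) := by linarith [heq x]
  rw [norm_gradient_rpow (hu.differentiable (by norm_num)) hpos hγ.le, lap_rpow hu hpos, hlap]
  set g := ‖gradient u x‖ with hg
  have hg0 : 0 ≤ g := norm_nonneg _
  have e1 : (γ * u x ^ (γ - 1) * g) ^ p = γ ^ p * u x ^ ((γ - 1) * p) * g ^ p := by
    rw [Real.mul_rpow (by positivity) hg0, Real.mul_rpow hγ.le (by positivity),
      ← Real.rpow_mul hx.le]
  have e2 : γ ^ (1 - p) * γ ^ p = γ := by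
    rw [← Real.rpow_add hγ, sub_add_cancel, Real.rpow_one]
  have e3 : u x ^ γ * u x ^ (γ - 1) * u x ^ q = u x ^ ((γ - 1) * p) := by
    rw [← Real.rpow_add hx, ← Real.rpow_add hx]
    congr 1
    linarith
  have e4 : u x ^ γ * u x ^ (γ - 2) = (u x ^ (γ - 1)) ^ 2 := by
    rw [pow_two, ← Real.rpow_add hx, ← Real.rpow_add hx]
    congr 1
    ring
  rw [e1, ← e3]
  have e5 : γ ^ (1 - p) * (γ ^ p * (u x ^ γ * u x ^ (γ - 1) * u x ^ q) * g ^ p) =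
      γ * (u x ^ γ * u x ^ (γ - 1) * u x ^ q) * g ^ p := by
    rw [← mul_assoc, ← mul_assoc, e2]
  have e6 : (1 - γ) / γ * (γ * u x ^ (γ - 1) * g) ^ 2 =
      (1 - γ) * γ * (u x ^ γ * u x ^ (γ - 2)) * g ^ 2 := by
    rw [e4]
    field_simp
  rw [e5, e6]
  ring

end SuperquadraticLiouville

open SuperquadraticLiouville in
/-- **Liouville-type theorem** (Theorem 1.1 extended, cf. Remark 1.1(b)): for `p ≥ 2` and `q > 1 - p`, any positive bounded
classical solution of `-Δu = u^q |∇u|^p` in `ℝⁿ` is constant. -/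
theorem liouville_superquadratic_extended {n : ℕ} (hn : 1 ≤ n) {p q : ℝ} (hp : 2 ≤ p) (hq : 1 - p < q)
    (u : EuclideanSpace ℝ (Fin n) → ℝ)
    (hu_pos : ∀ x, 0 < u x)
    (hu_bdd : ∃ M : ℝ, ∀ x, u x ≤ M)
    (hu_C2 : ContDiff ℝ 2 u)
    (heq : ∀ x, -lap u x = u x ^ q * ‖gradient u x‖ ^ p) :
    ∀ x y, u x = u y := by
  obtain ⟨M, hM⟩ := hu_bdd
  have hM0 : 0 < M := (hu_pos 0).trans_le (hM 0)
  have hsuper : ∀ x, lap u x ≤ 0 := fun x => by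
    have : 0 ≤ u x ^ q * ‖gradient u x‖ ^ p :=
      mul_nonneg (Real.rpow_nonneg (hu_pos x).le _) (Real.rpow_nonneg (norm_nonneg _) _)
    linarith [heq x]
  rcases hp.eq_or_lt with rfl | hp
  · have hK : 0 ≤ M ^ (q + 1) := Real.rpow_nonneg hM0.le _
    refine eq_of_lap_nonpos_of_lap_rpow_nonneg hu_C2 hu_pos hM hsuper (m := M ^ (q + 1) + 1)
      (by linarith) (lap_rpow_nonneg hu_C2 hu_pos (by linarith) fun x => ?_)
    have h1 : u x * lap u x = -(u x ^ (q + 1) * ‖gradient u x‖ ^ 2) := by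
      have := heq x
      rw [Real.rpow_two] at this
      rw [Real.rpow_add_one (hu_pos x).ne', show lap u x = -(u x ^ q * ‖gradient u x‖ ^ 2) by
        linarith]
      ring
    have h2 : u x ^ (q + 1) ≤ M ^ (q + 1) :=
      Real.rpow_le_rpow (hu_pos x).le (hM x) (by linarith)
    rw [h1, add_sub_cancel_right, neg_le_neg_iff]
    exact mul_le_mul_of_nonneg_right h2 (sq_nonneg _)
  · have hp2 : 0 < p - 2 := by linarith
    set γ := (p + q - 1) / (p - 2) with hγdef
    have hγ : 0 < γ := div_pos (by linarith) hp2
    have hγp : γ * (p - 2) = p + q - 1 := div_mul_cancel₀ _ hp2.ne'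
    set v : EuclideanSpace ℝ (Fin n) → ℝ := fun y => u y ^ γ with hv
    have hvC : ContDiff ℝ 2 v := hu_C2.rpow_const_of_ne fun x => (hu_pos x).ne'
    have hvpos : ∀ x, 0 < v x := fun x => Real.rpow_pos_of_pos (hu_pos x) _
    have hvM : ∀ x, v x ≤ M ^ γ := fun x => Real.rpow_le_rpow (hu_pos x).le (hM x) hγ.le
    have hveq := rpow_mul_lap_rpow hu_C2 hu_pos hγ hγp heq
    have hb : 0 < γ ^ (1 - p) := Real.rpow_pos_of_pos hγ _
    obtain ⟨K, hK⟩ := exists_norm_gradient_le hvC hvpos hvM hp hb hveq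
    have hK0 : 0 ≤ K := (norm_nonneg _).trans (hK 0)
    set k := |(1 - γ) / γ| + γ ^ (1 - p) * K ^ (p - 2) + 1 / γ + 1 with hk
    have hKp : 0 ≤ γ ^ (1 - p) * K ^ (p - 2) := mul_nonneg hb.le (Real.rpow_nonneg hK0 _)
    have hk1 : 1 / γ ≤ k := by
      have := abs_nonneg ((1 - γ) / γ)
      linarith
    have hγinv : 0 < 1 / γ := by positivity
    have hsub := lap_rpow_nonneg hvC hvpos (m := k) (by linarith) fun x => by
      rw [show v x * lap v x = _ from hveq x, neg_le_neg_iff]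
      have hg := norm_nonneg (gradient v x)
      have h1 : ‖gradient v x‖ ^ p = ‖gradient v x‖ ^ (p - 2) * ‖gradient v x‖ ^ 2 := by
        rw [← Real.rpow_natCast _ 2, ← Real.rpow_add_of_nonneg hg hp2.le (by norm_num)]
        norm_num
      have h2 : ‖gradient v x‖ ^ (p - 2) ≤ K ^ (p - 2) := Real.rpow_le_rpow hg (hK x) hp2.le
      have h3 : (1 - γ) / γ + γ ^ (1 - p) * ‖gradient v x‖ ^ (p - 2) ≤ k - 1 := by
        have := le_abs_self ((1 - γ) / γ)
        have := mul_le_mul_of_nonneg_left h2 hb.le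
        linarith
      rw [h1, ← mul_assoc, ← add_mul]
      exact mul_le_mul_of_nonneg_right h3 (sq_nonneg _)
    have hpow : (fun y => v y ^ k) = fun y => u y ^ (γ * k) := by
      funext y
      rw [hv, Real.rpow_mul (hu_pos y).le]
    rw [hpow] at hsub
    refine eq_of_lap_nonpos_of_lap_rpow_nonneg hu_C2 hu_pos hM hsuper (m := γ * k) ?_ hsub
    calc (1 : ℝ) = γ * (1 / γ) := by field_simp
      _ ≤ γ * k := mul_le_mul_of_nonneg_left hk1 hγ.le
end

section
/- Let n ≥ 1, p > 2 and q > 0, and let u : ℝ^n → ℝ be a positive, bounded, twice continuously differentiable function satisfying -Δu = u^q |∇u|^p at every point of ℝ^n. Then the function x ↦ u(x)^{q+1} |∇u(x)|^{p-2} is bounded on ℝ^n. -/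
open Filter Topology

/-- The second derivative of a function of one real variable is nonpositive at a local maximum. -/
lemma deriv_deriv_nonpos_of_isLocalMax {g : ℝ → ℝ} {a : ℝ} (h : IsLocalMax g a)
    (hc : ContinuousAt g a) : deriv (deriv g) a ≤ 0 := by
  by_contra! hpos
  have hmin := isLocalMin_of_deriv_deriv_pos hpos h.deriv_eq_zero hc
  have hconst : g =ᶠ[𝓝 a] fun _ => g a := by
    filter_upwards [h, hmin] with t h₁ h₂ using le_antisymm h₁ h₂
  have h₁ : deriv g =ᶠ[𝓝 a] fun _ => 0 := by
    simpa using hconst.deriv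
  have h₂ := h₁.deriv_eq
  simp only [deriv_const] at h₂
  exact hpos.ne' h₂

/-- The directional derivatives of a `C²` function are `C¹`. -/
lemma contDiff_fderiv_apply {E : Type*} [NormedAddCommGroup E] [NormedSpace ℝ E] {v : E → ℝ}
    (hv : ContDiff ℝ 2 v) (e : E) : ContDiff ℝ 1 fun y => fderiv ℝ v y e :=
  (hv.fderiv_right (by norm_num)).clm_apply contDiff_const

/-- The Laplacian of a `C²` function is nonpositive at a local maximum. -/
lemma lap_nonpos_of_isLocalMax {n : ℕ} {φ : EuclideanSpace ℝ (Fin n) → ℝ}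
    {x : EuclideanSpace ℝ (Fin n)} (hφ : ContDiff ℝ 2 φ) (h : IsLocalMax φ x) :
    lap φ x ≤ 0 := by
  refine Finset.sum_nonpos fun i _ => ?_
  set e : EuclideanSpace ℝ (Fin n) := EuclideanSpace.single i (1 : ℝ)
  have hline : ∀ t : ℝ, HasDerivAt (fun t : ℝ => x + t • e) e t := fun t => by
    simpa using ((hasDerivAt_id t).smul_const e).const_add x
  have hd : deriv (fun t : ℝ => φ (x + t • e)) = fun t => fderiv ℝ φ (x + t • e) e := by
    funext t
    exact ((hφ.differentiable (by norm_num) _).hasFDerivAt.comp_hasDerivAt t (hline t)).deriv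
  have hdd : deriv (deriv fun t : ℝ => φ (x + t • e)) 0 =
      fderiv ℝ (fun y => fderiv ℝ φ y e) x e := by
    rw [hd]
    have := (((contDiff_fderiv_apply hφ e).differentiable (by norm_num)
      (x + (0 : ℝ) • e)).hasFDerivAt.comp_hasDerivAt (0 : ℝ) (hline 0)).deriv
    simpa [Function.comp_def] using this
  have hcont : ContinuousAt (fun t : ℝ => x + t • e) 0 := (hline 0).continuousAt
  rw [← hdd]
  refine deriv_deriv_nonpos_of_isLocalMax ?_ ?_
  · have ht : Tendsto (fun t : ℝ => x + t • e) (𝓝 0) (𝓝 x) := by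
      simpa [ContinuousAt] using hcont
    have := ht.eventually h
    simpa [IsLocalMax, IsMaxFilter] using this
  · exact hφ.continuous.continuousAt.comp hcont

/-- The first and second order conditions at a maximum of `z ↦ v z - v (z + w) - ε‖z‖²`. -/
lemma conditions_of_isLocalMax_penalized {n : ℕ} {v : EuclideanSpace ℝ (Fin n) → ℝ}
    (hv : ContDiff ℝ 2 v) {x w : EuclideanSpace ℝ (Fin n)} {ε : ℝ}
    (h : IsLocalMax (fun z => v z - v (z + w) - ε * ‖z‖ ^ 2) x) :
    fderiv ℝ v x - fderiv ℝ v (x + w) = (2 * ε) • innerSL ℝ x ∧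
      lap v x - lap v (x + w) ≤ 2 * n * ε := by
  have hdv : Differentiable ℝ v := hv.differentiable (by norm_num)
  have hfd : ∀ z, HasFDerivAt (fun z => v z - v (z + w) - ε * ‖z‖ ^ 2)
      (fderiv ℝ v z - fderiv ℝ v (z + w) - (2 * ε) • innerSL ℝ z) z := fun z => by
    have h₁ := (hdv z).hasFDerivAt
    have h₂ : HasFDerivAt (fun z => v (z + w)) (fderiv ℝ v (z + w)) z :=
      (hasFDerivAt_comp_add_right w).2 (hdv (z + w)).hasFDerivAt
    have h₃ := ((hasStrictFDerivAt_norm_sq z).hasFDerivAt).const_mul ε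
    refine ((h₁.sub h₂).sub h₃).congr_fderiv ?_
    ext y
    simp
    ring
  constructor
  · have := h.hasFDerivAt_eq_zero (hfd x)
    exact sub_eq_zero.1 this
  · have hC : ContDiff ℝ 2 (fun z => v z - v (z + w) - ε * ‖z‖ ^ 2) :=
      (hv.sub (hv.comp (contDiff_id.add contDiff_const))).sub
        (contDiff_const.mul (contDiff_norm_sq ℝ))
    have hle := lap_nonpos_of_isLocalMax hC h
    have hlap : lap (fun z => v z - v (z + w) - ε * ‖z‖ ^ 2) x =
        lap v x - lap v (x + w) - 2 * n * ε := by
      have : 2 * n * ε = ∑ i : Fin n, 2 * ε := by simp; ring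
      rw [this]
      unfold lap
      rw [← Finset.sum_sub_distrib, ← Finset.sum_sub_distrib]
      refine Finset.sum_congr rfl fun i _ => ?_
      set e : EuclideanSpace ℝ (Fin n) := EuclideanSpace.single i (1 : ℝ) with he
      have hd := (contDiff_fderiv_apply hv e).differentiable (by norm_num)
      have h₁ := (hd x).hasFDerivAt
      have h₂ : HasFDerivAt (fun z => fderiv ℝ v (z + w) e)
          (fderiv ℝ (fun y => fderiv ℝ v y e) (x + w)) x :=
        (hasFDerivAt_comp_add_right (f := fun y => fderiv ℝ v y e) w).2 (hd (x + w)).hasFDerivAt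
      have h₃ : HasFDerivAt (fun z => 2 * ε * inner ℝ e z) ((2 * ε) • innerSL ℝ e) x :=
        (innerSL ℝ e).hasFDerivAt.const_mul (2 * ε)
      have heq : (fun y => fderiv ℝ (fun z => v z - v (z + w) - ε * ‖z‖ ^ 2) y e) =
          fun y => fderiv ℝ v y e - fderiv ℝ v (y + w) e - 2 * ε * inner ℝ e y := by
        funext y
        rw [(hfd y).fderiv]
        simp [real_inner_comm]
      rw [heq, ((h₁.fun_sub h₂).fun_sub h₃).fderiv]
      simp [he]
    linarith

/-- At a point `y ≠ x` minimizing `v + L‖x - ·‖`, the derivative of `v` has norm `L`. -/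
lemma norm_fderiv_eq_of_isLocalMin_add_norm {E : Type*} [NormedAddCommGroup E]
    [InnerProductSpace ℝ E] {v : E → ℝ} {x y : E} {L : ℝ} (hL : 0 ≤ L) (hxy : x ≠ y)
    (hv : DifferentiableAt ℝ v y) (h : IsLocalMin (fun z => v z + L * ‖z - x‖) y) :
    ‖fderiv ℝ v y‖ = L := by
  have hne : y - x ≠ 0 := sub_ne_zero.2 hxy.symm
  have : Nontrivial E := ⟨⟨x, y, hxy⟩⟩
  have hn : DifferentiableAt ℝ (fun z : E => ‖z‖) (y - x) :=
    (contDiffAt_norm ℝ hne).differentiableAt (n := 1) (by norm_num)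
  have h₁ : HasFDerivAt (fun z : E => ‖z - x‖) (fderiv ℝ (fun z : E => ‖z‖) (y - x)) y :=
    (hasFDerivAt_comp_sub x).2 hn.hasFDerivAt
  have h₂ := h.hasFDerivAt_eq_zero (hv.hasFDerivAt.add (h₁.const_mul L))
  rw [eq_neg_of_add_eq_zero_left h₂, norm_neg, norm_smul, norm_fderiv_norm hn,
    Real.norm_of_nonneg hL, mul_one]

/-- The doubled and penalized functional attains its maximum. -/
lemma exists_max_doubled {E : Type*} [NormedAddCommGroup E] [ProperSpace E] {v : E → ℝ}
    (hc : Continuous v) (hpos : ∀ x, 0 < v x) {M : ℝ} (hM : ∀ x, v x ≤ M) {L ε : ℝ} (hL : 0 < L)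
    (hε : 0 < ε) {x₀ y₀ : E} (h₀ : 0 ≤ v x₀ - v y₀ - L * ‖y₀ - x₀‖ - ε * ‖x₀‖ ^ 2) :
    ∃ x y, ∀ x' y', v x' - v y' - L * ‖y' - x'‖ - ε * ‖x'‖ ^ 2 ≤
      v x - v y - L * ‖y - x‖ - ε * ‖x‖ ^ 2 := by
  have hMpos : 0 < M := (hpos x₀).trans_le (hM x₀)
  let Φ : E × E → ℝ := fun z => v z.1 - v z.2 - L * ‖z.2 - z.1‖ - ε * ‖z.1‖ ^ 2
  have hΦ : Continuous Φ := by fun_prop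
  obtain ⟨z, hz⟩ := hΦ.exists_forall_ge' (x₀, y₀) (by
    set R := M / ε + 1
    filter_upwards [(isCompact_closedBall (0 : E × E) (R + M / L)).compl_mem_cocompact]
      with z hz
    refine le_trans ?_ h₀
    change v z.1 - v z.2 - L * ‖z.2 - z.1‖ - ε * ‖z.1‖ ^ 2 ≤ 0
    have hv₁ := hM z.1
    have hv₂ := hpos z.2
    have hML : L * (M / L) = M := by field_simp
    have hMε : ε * (M / ε) = M := by field_simp
    have hML0 : 0 < M / L := by positivity
    have hMε0 : 0 < M / ε := by positivity
    by_cases hR : ‖z.1‖ ≤ R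
    · have hz' : R + M / L < ‖z.2‖ := by
        simp only [Set.mem_compl_iff, mem_closedBall_zero_iff, Prod.norm_def, sup_le_iff,
          not_and, not_le] at hz
        exact hz (by linarith)
      have htri : ‖z.2‖ ≤ ‖z.2 - z.1‖ + ‖z.1‖ := by
        simpa using norm_add_le (z.2 - z.1) z.1
      have : L * (M / L) ≤ L * ‖z.2 - z.1‖ := by gcongr; linarith
      have : 0 ≤ ε * ‖z.1‖ ^ 2 := by positivity
      linarith
    · push Not at hR
      have h₁ : M / ε ≤ ‖z.1‖ ^ 2 := by
        have : (1 : ℝ) ≤ R := by simp only [R]; linarith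
        have : M / ε ≤ R := by simp only [R]; linarith
        nlinarith
      have : ε * (M / ε) ≤ ε * ‖z.1‖ ^ 2 := by gcongr
      have : 0 ≤ L * ‖z.2 - z.1‖ := by positivity
      linarith)
  exact ⟨z.1, z.2, fun x' y' => hz (x', y')⟩

/-- A bounded positive `C²` solution of `-v Δv = H(|∇v|)` on `ℝⁿ` is `L`-Lipschitz as soon as
`H L > 0`. -/
lemma sub_le_of_neg_lap_mul_eq {n : ℕ} {v : EuclideanSpace ℝ (Fin n) → ℝ} (hv : ContDiff ℝ 2 v)
    (hpos : ∀ x, 0 < v x) {M : ℝ} (hM : ∀ x, v x ≤ M) {H : ℝ → ℝ} {L : ℝ}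
    (hH : ContinuousAt H L) (hL : 0 < L) (hHL : 0 < H L)
    (heq : ∀ x, -lap v x * v x = H ‖fderiv ℝ v x‖) (x₀ y₀ : EuclideanSpace ℝ (Fin n)) :
    v x₀ - v y₀ ≤ L * ‖y₀ - x₀‖ := by
  by_contra! hcon
  have hMpos : 0 < M := (hpos x₀).trans_le (hM x₀)
  set δ := v x₀ - v y₀ - L * ‖y₀ - x₀‖ with hδ
  have hδpos : 0 < δ := by linarith
  set θ := δ / (2 * M) with hθ
  have hθpos : 0 < θ := by positivity
  obtain ⟨η, hη, hηH⟩ : ∃ η > 0, ∀ s, |s - L| < η → H s ≤ (1 + θ) * H L := by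
    have hev : ∀ᶠ s in 𝓝 L, H s < (1 + θ) * H L :=
      hH.eventually_lt continuousAt_const (by nlinarith [mul_pos hθpos hHL])
    obtain ⟨η, hη, h⟩ := Metric.eventually_nhds_iff.1 hev
    exact ⟨η, hη, fun s hs => (h (by rwa [Real.dist_eq])).le⟩
  -- a penalization parameter that is small in all the required senses
  obtain ⟨ε, hε, hε₁, hε₂, hε₃⟩ : ∃ ε > 0, ε * ‖x₀‖ ^ 2 ≤ δ / 2 ∧ 4 * ε * M < η ^ 2 ∧
      2 * n * ε * M < θ ^ 2 * H L := by
    have hlim : ∀ a b : ℝ, 0 < b → ∀ᶠ ε : ℝ in 𝓝[>] 0, a * ε < b := fun a b hb => by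
      have : Tendsto (fun ε : ℝ => a * ε) (𝓝 0) (𝓝 (a * 0)) := tendsto_id.const_mul a
      rw [mul_zero] at this
      exact (this.eventually (gt_mem_nhds hb)).filter_mono nhdsWithin_le_nhds
    obtain ⟨ε, h₁, h₂, h₃, h₄⟩ := ((hlim (‖x₀‖ ^ 2) (δ / 2) (by positivity)).and
      ((hlim (4 * M) (η ^ 2) (by positivity)).and
        ((hlim (2 * n * M) (θ ^ 2 * H L) (by positivity)).and
          self_mem_nhdsWithin))).exists
    exact ⟨ε, h₄, by linarith, by linarith, by linarith⟩
  obtain ⟨x, y, hmax⟩ := exists_max_doubled hv.continuous hpos hM hL hε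
    (x₀ := x₀) (y₀ := y₀) (by linarith)
  have hval : δ / 2 ≤ v x - v y - L * ‖y - x‖ - ε * ‖x‖ ^ 2 :=
    le_trans (by linarith) (hmax x₀ y₀)
  have hpen : 0 ≤ ε * ‖x‖ ^ 2 := by positivity
  have hdist : 0 ≤ L * ‖y - x‖ := by positivity
  have hxy : x ≠ y := by
    rintro rfl
    simp at hval
    linarith
  have hgy : ‖fderiv ℝ v y‖ = L := by
    refine norm_fderiv_eq_of_isLocalMin_add_norm hL.le hxy (hv.differentiable (by norm_num) y)
      (Eventually.of_forall fun z => ?_)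
    have := hmax x z
    linarith
  obtain ⟨hgrad, hlap⟩ := conditions_of_isLocalMax_penalized hv (x := x) (w := y - x) (ε := ε)
    (Eventually.of_forall fun z => by
      have := hmax z (z + (y - x))
      simp only [add_sub_cancel_left, add_sub_cancel] at this ⊢
      linarith)
  rw [add_sub_cancel] at hgrad hlap
  have hgx : |‖fderiv ℝ v x‖ - L| < η := by
    have h₁ : |‖fderiv ℝ v x‖ - L| ≤ 2 * ε * ‖x‖ := by
      rw [← hgy]
      refine (abs_norm_sub_norm_le _ _).trans ?_
      rw [hgrad, norm_smul, innerSL_apply_norm, Real.norm_of_nonneg (by positivity)]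
    refine h₁.trans_lt (lt_of_pow_lt_pow_left₀ 2 hη.le ?_)
    have : ε * ‖x‖ ^ 2 ≤ M := by linarith [hM x, hpos y]
    have : 4 * ε * (ε * ‖x‖ ^ 2) ≤ 4 * ε * M := by gcongr
    linarith
  have hHx := hηH _ hgx
  have hex := heq x
  have hey := heq y
  rw [hgy] at hey
  have hvx := hpos x
  have hvy := hpos y
  -- the ratio `v y / v x` stays below `1 - θ`
  have hratio : v y / v x ≤ 1 - θ := by
    rw [div_le_iff₀ hvx]
    have : θ * v x ≤ θ * M := by gcongr; exact hM x
    have : θ * M = δ / 2 := by rw [hθ]; field_simp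
    linarith
  have hr : 0 < v y / v x := by positivity
  have hkey : H L - v y / v x * H ‖fderiv ℝ v x‖ ≤ 2 * n * ε * M := by
    have h₁ : H L - v y / v x * H ‖fderiv ℝ v x‖ = v y * (lap v x - lap v y) := by
      rw [← hex, ← hey]; field_simp; ring
    rw [h₁]
    calc v y * (lap v x - lap v y) ≤ v y * (2 * n * ε) := by gcongr
      _ ≤ M * (2 * n * ε) := by gcongr; exact hM y
      _ = 2 * n * ε * M := by ring
  have h₂ : v y / v x * H ‖fderiv ℝ v x‖ ≤ (1 - θ) * ((1 + θ) * H L) :=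
    calc v y / v x * H ‖fderiv ℝ v x‖ ≤ v y / v x * ((1 + θ) * H L) := by gcongr
      _ ≤ (1 - θ) * ((1 + θ) * H L) := by gcongr
  nlinarith

/-- The norm of the gradient is the norm of the derivative. -/
lemma norm_gradient_eq {E : Type*} [NormedAddCommGroup E] [InnerProductSpace ℝ E]
    [CompleteSpace E] (u : E → ℝ) (x : E) : ‖gradient u x‖ = ‖fderiv ℝ u x‖ := by
  simp [gradient]

/-- The squares of the partial derivatives sum to the square of the norm of the gradient. -/
lemma sum_fderiv_single_sq {n : ℕ} (u : EuclideanSpace ℝ (Fin n) → ℝ)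
    (x : EuclideanSpace ℝ (Fin n)) :
    ∑ i : Fin n, fderiv ℝ u x (EuclideanSpace.single i (1 : ℝ)) ^ 2 = ‖gradient u x‖ ^ 2 := by
  rw [EuclideanSpace.norm_sq_eq]
  refine Finset.sum_congr rfl fun i _ => ?_
  have h : fderiv ℝ u x (EuclideanSpace.single i (1 : ℝ)) = gradient u x i := by
    have : inner ℝ (gradient u x) (EuclideanSpace.single i (1 : ℝ)) =
        fderiv ℝ u x (EuclideanSpace.single i (1 : ℝ)) := by
      simp only [gradient, InnerProductSpace.toDual_symm_apply]
    rw [← this, EuclideanSpace.inner_single_right]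
    simp
  rw [h, Real.norm_eq_abs, sq_abs]

/-- The derivative of a real power of a positive function. -/
lemma hasFDerivAt_rpow_comp {E : Type*} [NormedAddCommGroup E] [NormedSpace ℝ E] {u : E → ℝ}
    (hu : Differentiable ℝ u) (hpos : ∀ x, 0 < u x) (b : ℝ) (x : E) :
    HasFDerivAt (fun y => u y ^ b) ((b * u x ^ (b - 1)) • fderiv ℝ u x) x :=
  (hu x).hasFDerivAt.rpow_const (Or.inl (hpos x).ne')

/-- The Laplacian of a real power of a positive function. -/
lemma lap_rpow {n : ℕ} {u : EuclideanSpace ℝ (Fin n) → ℝ} (hu : ContDiff ℝ 2 u)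
    (hpos : ∀ x, 0 < u x) (b : ℝ) (x : EuclideanSpace ℝ (Fin n)) :
    lap (fun y => u y ^ b) x =
      b * u x ^ (b - 1) * lap u x + b * (b - 1) * u x ^ (b - 2) * ‖gradient u x‖ ^ 2 := by
  have hd : Differentiable ℝ u := hu.differentiable (by norm_num)
  rw [← sum_fderiv_single_sq, lap, lap, Finset.mul_sum, Finset.mul_sum, ← Finset.sum_add_distrib]
  refine Finset.sum_congr rfl fun i _ => ?_
  set e : EuclideanSpace ℝ (Fin n) := EuclideanSpace.single i (1 : ℝ)
  have heq : (fun y => fderiv ℝ (fun y => u y ^ b) y e) =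
      fun y => b * u y ^ (b - 1) * fderiv ℝ u y e := by
    funext y
    rw [(hasFDerivAt_rpow_comp hd hpos b y).fderiv]
    simp
  have h₁ := (hasFDerivAt_rpow_comp hd hpos (b - 1) x).const_mul b
  have h₂ := ((contDiff_fderiv_apply hu e).differentiable (by norm_num) x).hasFDerivAt
  rw [heq, (h₁.fun_mul h₂).fderiv]
  simp only [add_apply, smul_apply, smul_eq_mul]
  rw [show b - 1 - 1 = b - 2 by ring]
  ring

/-- **Gradient bound** (Lemma 2.1): for `p > 2` and `q > 0`, if `u` is a positive bounded
classical solution of `-Δu = u^q |∇u|^p` in `ℝⁿ`, then `u^{q+1} |∇u|^{p-2}` is bounded. -/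
theorem gradient_bound {n : ℕ} (hn : 1 ≤ n) {p q : ℝ} (hp : 2 < p) (hq : 0 < q)
    (u : EuclideanSpace ℝ (Fin n) → ℝ)
    (hu_pos : ∀ x, 0 < u x)
    (hu_bdd : ∃ M : ℝ, ∀ x, u x ≤ M)
    (hu_C2 : ContDiff ℝ 2 u)
    (heq : ∀ x, -lap u x = u x ^ q * ‖gradient u x‖ ^ p) :
    ∃ C : ℝ, ∀ x, u x ^ (q + 1) * ‖gradient u x‖ ^ (p - 2) ≤ C := by
  obtain ⟨M, hM⟩ := hu_bdd
  have hp2 : 0 < p - 2 := by linarith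
  -- the power `v = u ^ b` solves `-v Δv = c |∇v|^p - k |∇v|²`
  set b : ℝ := (p + q - 1) / (p - 2) with hb
  have hbp : b * (p - 2) = p + q - 1 := by rw [hb]; field_simp
  have hb1 : (b - 1) * (p - 2) = q + 1 := by linarith
  have hbpos : 0 < b := by apply div_pos <;> linarith
  have hd : Differentiable ℝ u := hu_C2.differentiable (by norm_num)
  have hgrad : ∀ x, ‖fderiv ℝ (fun y => u y ^ b) x‖ = b * u x ^ (b - 1) * ‖gradient u x‖ := by
    intro x
    have := Real.rpow_pos_of_pos (hu_pos x) (b - 1)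
    rw [(hasFDerivAt_rpow_comp hd hu_pos b x).fderiv, norm_smul, norm_gradient_eq,
      Real.norm_of_nonneg (by positivity)]
  have hC : ContDiff ℝ 2 fun y => u y ^ b := hu_C2.rpow_const_of_ne fun x => (hu_pos x).ne'
  set H : ℝ → ℝ := fun s => b ^ (1 - p) * s ^ p - (b - 1) / b * s ^ 2 with hH
  have hveq : ∀ x, -lap (fun y => u y ^ b) x * u x ^ b = H ‖fderiv ℝ (fun y => u y ^ b) x‖ := by
    intro x
    have hux := hu_pos x
    rw [lap_rpow hu_C2 hu_pos, hgrad, hH]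
    set g := ‖gradient u x‖ with hg
    have hg0 : 0 ≤ g := norm_nonneg _
    have hl : lap u x = -(u x ^ q * g ^ p) := by rw [hg, ← heq x]; ring
    have h₁ : (b * u x ^ (b - 1) * g) ^ p = b ^ p * u x ^ ((b - 1) * p) * g ^ p := by
      rw [Real.mul_rpow (by positivity) hg0, Real.mul_rpow hbpos.le (by positivity),
        ← Real.rpow_mul hux.le]
    have h₂ : u x ^ ((b - 1) * p) = u x ^ (b - 1) * u x ^ q * u x ^ b := by
      rw [← Real.rpow_add hux, ← Real.rpow_add hux]
      congr 1
      linarith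
    have h₃ : (u x ^ (b - 1)) ^ 2 = u x ^ (b - 2) * u x ^ b := by
      rw [← Real.rpow_natCast, ← Real.rpow_mul hux.le, ← Real.rpow_add hux]
      congr 1
      push_cast
      ring
    have h₄ : b ^ (1 - p) * b ^ p = b := by
      rw [← Real.rpow_add hbpos]; simp
    have h₅ : (b - 1) / b * b ^ 2 = b * (b - 1) := by field_simp
    beta_reduce
    rw [h₁, h₂, hl]
    linear_combination (-(u x ^ (b - 1) * u x ^ q * u x ^ b * g ^ p)) * h₄ +
      (b - 1) / b * b ^ 2 * g ^ 2 * h₃ + g ^ 2 * u x ^ (b - 2) * u x ^ b * h₅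
  obtain ⟨L, hL, hHL⟩ : ∃ L > 0, 0 < H L := by
    have hc : 0 < b ^ (1 - p) := Real.rpow_pos_of_pos hbpos _
    obtain ⟨L, hL₁, hL₂⟩ := (((tendsto_rpow_atTop hp2).eventually_gt_atTop
      ((b - 1) / b / b ^ (1 - p))).and (eventually_gt_atTop 0)).exists
    refine ⟨L, hL₂, ?_⟩
    rw [div_lt_iff₀ hc] at hL₁
    have hLp : L ^ p = L ^ (p - 2) * L ^ 2 := by
      rw [← Real.rpow_natCast, ← Real.rpow_add hL₂]; norm_num
    have hL2 : 0 < L ^ 2 := by positivity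
    simp only [hH]
    rw [hLp]
    nlinarith
  have hcont : ContinuousAt H L := by
    have := Real.continuousAt_rpow_const L p (Or.inl hL.ne')
    exact (continuousAt_const.mul this).sub (by fun_prop)
  have hlip := sub_le_of_neg_lap_mul_eq hC (fun x => Real.rpow_pos_of_pos (hu_pos x) b)
    (fun x => Real.rpow_le_rpow (hu_pos x).le (hM x) hbpos.le) hcont hL hHL hveq
  have hLip : LipschitzWith L.toNNReal fun y => u y ^ b := by
    refine LipschitzWith.of_le_add_mul _ fun x y => ?_
    have := hlip x y
    rw [dist_comm, dist_eq_norm, Real.coe_toNNReal L hL.le]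
    linarith
  refine ⟨(L / b) ^ (p - 2), fun x => ?_⟩
  have hux := hu_pos x
  have hfd : b * u x ^ (b - 1) * ‖gradient u x‖ ≤ L := by
    rw [← hgrad]
    simpa [hL.le] using norm_fderiv_le_of_lipschitz ℝ hLip (x₀ := x)
  have hpow : u x ^ (q + 1) * ‖gradient u x‖ ^ (p - 2) =
      (u x ^ (b - 1) * ‖gradient u x‖) ^ (p - 2) := by
    rw [Real.mul_rpow (by positivity) (norm_nonneg _), ← Real.rpow_mul hux.le, hb1]
  rw [hpow]
  refine Real.rpow_le_rpow (by positivity) ?_ hp2.le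
  rw [le_div_iff₀ hbpos]
  linarith
end

section
/- Let n ≥ 1 and let f, g : ℝ^n × [0,∞)² × ℝ^n × ℝ^n → ℝ be nonnegative functions such that for each M > 0 there is a constant K(M) > 0 with u·f(x,u,v,ξ,ζ) ≤ K(M)|ξ|² and v·g(x,u,v,ξ,ζ) ≤ K(M)|ζ|² for all x ∈ ℝ^n, all (u,v) ∈ [0,M]² and all ξ, ζ ∈ ℝ^n. Then any pair (u, v) of nonnegative, bounded, twice continuously differentiable functions on ℝ^n satisfying -Δu(x) = f(x, u(x), v(x), ∇u(x), ∇v(x)) and -Δv(x) = g(x, u(x), v(x), ∇u(x), ∇v(x)) for all x ∈ ℝ^n must be a pair of constant functions. -/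
open MeasureTheory Filter Topology

/-- The square of the positive part is differentiable. -/
lemma hasDerivAt_max_zero_sq (t : ℝ) :
    HasDerivAt (fun s : ℝ => max 0 s ^ 2) (2 * max 0 t) t := by
  rcases lt_trichotomy t 0 with ht | rfl | ht
  · rw [max_eq_left ht.le, mul_zero]
    refine (hasDerivAt_const t (0 : ℝ)).congr_of_eventuallyEq ?_
    filter_upwards [Iio_mem_nhds ht] with s hs
    simp [max_eq_left (Set.mem_Iio.1 hs).le]
  · rw [max_self, mul_zero, hasDerivAt_iff_isLittleO]
    have h : (fun s : ℝ => s ^ 2) =o[𝓝 0] fun s : ℝ => s := by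
      simpa using Asymptotics.isLittleO_pow_pow (𝕜 := ℝ) (m := 1) (n := 2) (by norm_num)
    simp only [max_self, sub_zero, smul_zero, ne_eq, OfNat.ofNat_ne_zero, not_false_eq_true,
      zero_pow]
    refine (Asymptotics.IsBigO.of_bound 1 (Eventually.of_forall fun s => ?_)).trans_isLittleO h
    rw [one_mul, norm_pow, norm_pow]
    gcongr
    rcases le_total 0 s with hs | hs
    · rw [max_eq_right hs]
    · simp [max_eq_left hs]
  · rw [max_eq_right ht.le]
    have h := hasDerivAt_pow 2 t
    norm_num at h
    refine h.congr_of_eventuallyEq ?_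
    filter_upwards [Ioi_mem_nhds ht] with s hs
    simp [max_eq_right (Set.mem_Ioi.1 hs).le]

section Kernel

variable {n : ℕ}

/-- The averaging kernel `(1 - |y|²)₊`. -/
noncomputable def averagingKernel (y : EuclideanSpace ℝ (Fin n)) : ℝ := max 0 (1 - ‖y‖ ^ 2)

lemma continuous_averagingKernel : Continuous (averagingKernel (n := n)) := by
  unfold averagingKernel
  fun_prop

lemma averagingKernel_nonneg (y : EuclideanSpace ℝ (Fin n)) : 0 ≤ averagingKernel y :=
  le_max_left _ _

lemma averagingKernel_le_one (y : EuclideanSpace ℝ (Fin n)) : averagingKernel y ≤ 1 :=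
  max_le zero_le_one (by nlinarith [sq_nonneg ‖y‖])

lemma averagingKernel_eq_zero {y : EuclideanSpace ℝ (Fin n)} (hy : 1 ≤ ‖y‖) :
    averagingKernel y = 0 :=
  max_eq_left (by nlinarith)

lemma hasCompactSupport_averagingKernel : HasCompactSupport (averagingKernel (n := n)) := by
  refine HasCompactSupport.intro (isCompact_closedBall 0 1) fun y hy => ?_
  rw [mem_closedBall_zero_iff, not_le] at hy
  exact averagingKernel_eq_zero hy.le

lemma integral_averagingKernel_pos :
    0 < ∫ y : EuclideanSpace ℝ (Fin n), averagingKernel y :=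
  continuous_averagingKernel.integral_pos_of_hasCompactSupport_nonneg_nonzero
    hasCompactSupport_averagingKernel averagingKernel_nonneg (x := 0)
    (by simp [averagingKernel])

lemma integrable_mul_averagingKernel {w : EuclideanSpace ℝ (Fin n) → ℝ} (hw : Continuous w) :
    Integrable fun y => w y * averagingKernel y :=
  (hw.mul continuous_averagingKernel).integrable_of_hasCompactSupport
    hasCompactSupport_averagingKernel.mul_left

lemma hasFDerivAt_averagingKernel_sq (y : EuclideanSpace ℝ (Fin n)) :
    HasFDerivAt (fun z : EuclideanSpace ℝ (Fin n) => averagingKernel z ^ 2)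
      ((2 * averagingKernel y) •
        -((2 : ℕ) • (innerSL ℝ y : EuclideanSpace ℝ (Fin n) →L[ℝ] ℝ))) y := by
  have h := (hasDerivAt_max_zero_sq (1 - ‖y‖ ^ 2)).comp_hasFDerivAt y
    ((hasStrictFDerivAt_norm_sq y).hasFDerivAt.const_sub 1)
  exact h

lemma fderiv_averagingKernel_sq_single (y : EuclideanSpace ℝ (Fin n)) (i : Fin n) :
    fderiv ℝ (fun z : EuclideanSpace ℝ (Fin n) => averagingKernel z ^ 2) y
      (EuclideanSpace.single i 1) = -4 * (y i * averagingKernel y) := by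
  rw [(hasFDerivAt_averagingKernel_sq y).fderiv]
  simp [EuclideanSpace.inner_single_right]
  ring

/-- Integration by parts against the potential of the averaging kernel. -/
lemma integral_mul_coord_mul_averagingKernel {w : EuclideanSpace ℝ (Fin n) → ℝ}
    (hw : ContDiff ℝ 1 w) (i : Fin n) :
    ∫ y, w y * (y i * averagingKernel y) =
      (1 / 4) * ∫ y, fderiv ℝ w y (EuclideanSpace.single i 1) * averagingKernel y ^ 2 := by
  have hker2 : HasCompactSupport fun y : EuclideanSpace ℝ (Fin n) => averagingKernel y ^ 2 :=
    hasCompactSupport_averagingKernel.comp_left (g := fun t : ℝ => t ^ 2) (by simp)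
  have hcont := continuous_averagingKernel (n := n)
  have hw' : Continuous fun y => fderiv ℝ w y (EuclideanSpace.single i 1) :=
    (hw.continuous_fderiv one_ne_zero).clm_apply continuous_const
  have hcoord : Continuous fun y : EuclideanSpace ℝ (Fin n) => y i := by fun_prop
  have key := integral_mul_fderiv_eq_neg_fderiv_mul_of_integrable
    (μ := (volume : Measure (EuclideanSpace ℝ (Fin n)))) (f := w)
    (g := fun y => averagingKernel y ^ 2) (v := EuclideanSpace.single i (1 : ℝ))
    ((hw'.mul (hcont.pow 2)).integrable_of_hasCompactSupport hker2.mul_left)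
    (by
      simp only [fderiv_averagingKernel_sq_single]
      refine (hw.continuous.mul
        (continuous_const.mul (hcoord.mul hcont))).integrable_of_hasCompactSupport ?_
      exact hasCompactSupport_averagingKernel.mul_left.mul_left.mul_left)
    ((hw.continuous.mul (hcont.pow 2)).integrable_of_hasCompactSupport hker2.mul_left)
    (fun y _ => (hw.differentiable one_ne_zero) y)
    (fun y _ => (hasFDerivAt_averagingKernel_sq y).differentiableAt)
  simp only [fderiv_averagingKernel_sq_single] at key
  have h4 : ∀ y : EuclideanSpace ℝ (Fin n), w y * (-4 * (y i * averagingKernel y)) =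
      -4 * (w y * (y i * averagingKernel y)) := fun y => by ring
  simp only [h4, integral_const_mul] at key
  linarith

/-- The unnormalised weighted average of `w` over the ball of radius `r` about `x`. -/
noncomputable def ballAverage (w : EuclideanSpace ℝ (Fin n) → ℝ) (x : EuclideanSpace ℝ (Fin n))
    (r : ℝ) : ℝ :=
  ∫ y, w (x + r • y) * averagingKernel y

lemma hasDerivAt_ballAverage {w : EuclideanSpace ℝ (Fin n) → ℝ} (hw : ContDiff ℝ 1 w)
    (x : EuclideanSpace ℝ (Fin n)) (r : ℝ) :
    HasDerivAt (ballAverage w x) (∫ y, fderiv ℝ w (x + r • y) y * averagingKernel y) r := by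
  have hw' : Continuous (fderiv ℝ w) := hw.continuous_fderiv one_ne_zero
  obtain ⟨C, hC⟩ := ((isCompact_closedBall r 1).prod
    (isCompact_closedBall (0 : EuclideanSpace ℝ (Fin n)) 1)).exists_bound_of_continuousOn
    (f := fun p : ℝ × EuclideanSpace ℝ (Fin n) => fderiv ℝ w (x + p.1 • p.2) p.2)
    (by fun_prop)
  have hcont := continuous_averagingKernel (n := n)
  have hw0 := hw.continuous
  refine (hasDerivAt_integral_of_dominated_loc_of_deriv_le (bound := fun y => C * averagingKernel y)
    (F := fun r y => w (x + r • y) * averagingKernel y)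
    (F' := fun r y => fderiv ℝ w (x + r • y) y * averagingKernel y)
    (Metric.closedBall_mem_nhds r one_pos) ?_ ?_ ?_ ?_ ?_ ?_).2
  · exact Eventually.of_forall fun s => Continuous.aestronglyMeasurable (by fun_prop)
  · exact integrable_mul_averagingKernel (by fun_prop)
  · exact Continuous.aestronglyMeasurable (by fun_prop)
  · refine Eventually.of_forall fun y s hs => ?_
    rw [norm_mul, Real.norm_of_nonneg (averagingKernel_nonneg y)]
    rcases le_total ‖y‖ 1 with hy | hy
    · exact mul_le_mul_of_nonneg_right (hC (s, y) ⟨hs, mem_closedBall_zero_iff.2 hy⟩)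
        (averagingKernel_nonneg y)
    · simp [averagingKernel_eq_zero hy]
  · exact integrable_mul_averagingKernel continuous_const
  · refine Eventually.of_forall fun y s _ => ?_
    have h1 : HasDerivAt (fun s : ℝ => x + s • y) y s := by
      simpa using ((hasDerivAt_id s).smul_const y).const_add x
    exact (((hw.differentiable one_ne_zero) (x + s • y)).hasFDerivAt.comp_hasDerivAt s
      h1).mul_const _

lemma integral_fderiv_mul_averagingKernel {w : EuclideanSpace ℝ (Fin n) → ℝ}
    (hw : ContDiff ℝ 2 w) (x : EuclideanSpace ℝ (Fin n)) (r : ℝ) :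
    ∫ y, fderiv ℝ w (x + r • y) y * averagingKernel y =
      r / 4 * ∫ y, lap w (x + r • y) * averagingKernel y ^ 2 := by
  have hpartial : ∀ i : Fin n,
      ContDiff ℝ 1 fun y => fderiv ℝ w y (EuclideanSpace.single i (1 : ℝ)) := fun i =>
    (hw.fderiv_right (m := 1) (by norm_num)).clm_apply contDiff_const
  have hline : ContDiff ℝ 1 fun y : EuclideanSpace ℝ (Fin n) => x + r • y := by fun_prop
  have hsecond : ∀ (i : Fin n) (y : EuclideanSpace ℝ (Fin n)),
      fderiv ℝ (fun z => fderiv ℝ w (x + r • z) (EuclideanSpace.single i (1 : ℝ))) y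
        (EuclideanSpace.single i 1) =
      r * fderiv ℝ (fun z => fderiv ℝ w z (EuclideanSpace.single i (1 : ℝ))) (x + r • y)
        (EuclideanSpace.single i 1) := by
    intro i y
    have h1 : HasFDerivAt (fun z : EuclideanSpace ℝ (Fin n) => x + r • z)
        (r • ContinuousLinearMap.id ℝ (EuclideanSpace ℝ (Fin n))) y :=
      ((hasFDerivAt_id y).const_smul r).const_add x
    have h2 := (((hpartial i).differentiable one_ne_zero) (x + r • y)).hasFDerivAt.comp y h1
    rw [Function.comp_def] at h2
    rw [h2.fderiv]
    simp
  have hexpand : ∀ y : EuclideanSpace ℝ (Fin n),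
      fderiv ℝ w (x + r • y) y * averagingKernel y =
      ∑ i, fderiv ℝ w (x + r • y) (EuclideanSpace.single i 1) * (y i * averagingKernel y) := by
    intro y
    have hy : y = ∑ i, y i • EuclideanSpace.single i (1 : ℝ) := by
      simpa using ((EuclideanSpace.basisFun (Fin n) ℝ).sum_repr y).symm
    conv_lhs => rw [show fderiv ℝ w (x + r • y) y = fderiv ℝ w (x + r • y)
      (∑ i, y i • EuclideanSpace.single i (1 : ℝ)) by rw [← hy]]
    rw [map_sum, Finset.sum_mul]
    refine Finset.sum_congr rfl fun i _ => ?_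
    rw [map_smul, smul_eq_mul]
    ring
  have hcont := continuous_averagingKernel (n := n)
  have hint1 : ∀ i : Fin n, Integrable fun y : EuclideanSpace ℝ (Fin n) =>
      fderiv ℝ w (x + r • y) (EuclideanSpace.single i 1) * (y i * averagingKernel y) := by
    intro i
    have hc : Continuous fun y : EuclideanSpace ℝ (Fin n) =>
        fderiv ℝ w (x + r • y) (EuclideanSpace.single i 1) * y i :=
      ((hpartial i).comp hline).continuous.mul (by fun_prop)
    simpa only [mul_assoc] using integrable_mul_averagingKernel hc
  have hint2 : ∀ i : Fin n, Integrable fun y : EuclideanSpace ℝ (Fin n) =>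
      fderiv ℝ (fun z => fderiv ℝ w z (EuclideanSpace.single i (1 : ℝ))) (x + r • y)
        (EuclideanSpace.single i 1) * averagingKernel y ^ 2 := by
    intro i
    have hc : Continuous fun y : EuclideanSpace ℝ (Fin n) =>
        fderiv ℝ (fun z => fderiv ℝ w z (EuclideanSpace.single i (1 : ℝ))) (x + r • y)
          (EuclideanSpace.single i 1) * averagingKernel y :=
      ((((hpartial i).continuous_fderiv one_ne_zero).comp hline.continuous).clm_apply
        continuous_const).mul hcont
    simpa only [mul_assoc, sq] using integrable_mul_averagingKernel hc
  simp only [hexpand, lap, Finset.sum_mul]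
  rw [integral_finsetSum _ fun i _ => hint1 i, integral_finsetSum _ fun i _ => hint2 i,
    Finset.mul_sum]
  refine Finset.sum_congr rfl fun i _ => ?_
  have hparts := integral_mul_coord_mul_averagingKernel ((hpartial i).comp hline) i
  simp only [Function.comp_def, hsecond, mul_assoc, integral_const_mul] at hparts
  rw [hparts]
  ring

/-- Mean value inequality for superharmonic functions. -/
lemma ballAverage_le_of_lap_nonpos {w : EuclideanSpace ℝ (Fin n) → ℝ} (hw : ContDiff ℝ 2 w)
    (hlap : ∀ x, lap w x ≤ 0) (x : EuclideanSpace ℝ (Fin n)) {r : ℝ} (hr : 0 ≤ r) :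
    ballAverage w x r ≤ w x * ∫ y : EuclideanSpace ℝ (Fin n), averagingKernel y := by
  have hder := hasDerivAt_ballAverage (hw.of_le one_le_two) x
  have hanti : AntitoneOn (ballAverage w x) (Set.Ici 0) := by
    refine antitoneOn_of_deriv_nonpos (convex_Ici 0)
      (fun s _ => (hder s).continuousAt.continuousWithinAt)
      (fun s _ => (hder s).differentiableAt.differentiableWithinAt) fun s hs => ?_
    rw [interior_Ici, Set.mem_Ioi] at hs
    rw [(hder s).deriv, integral_fderiv_mul_averagingKernel hw]
    exact mul_nonpos_of_nonneg_of_nonpos (by positivity)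
      (integral_nonpos fun y => mul_nonpos_of_nonpos_of_nonneg (hlap _) (sq_nonneg _))
  have h := hanti Set.self_mem_Ici hr hr
  simpa [ballAverage, integral_const_mul] using h

lemma lap_neg (w : EuclideanSpace ℝ (Fin n) → ℝ) (x : EuclideanSpace ℝ (Fin n)) :
    lap (fun y => -w y) x = -lap w x := by
  simp [lap, fderiv_fun_neg]

/-- Mean value inequality for subharmonic functions. -/
lemma le_ballAverage_of_lap_nonneg {w : EuclideanSpace ℝ (Fin n) → ℝ} (hw : ContDiff ℝ 2 w)
    (hlap : ∀ x, 0 ≤ lap w x) (x : EuclideanSpace ℝ (Fin n)) {r : ℝ} (hr : 0 ≤ r) :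
    w x * ∫ y : EuclideanSpace ℝ (Fin n), averagingKernel y ≤ ballAverage w x r := by
  have h := ballAverage_le_of_lap_nonpos hw.neg
    (fun y => by rw [lap_neg]; exact neg_nonpos.2 (hlap y)) x hr
  simp only [ballAverage, neg_mul, integral_neg] at h
  exact neg_le_neg_iff.1 h

lemma tendsto_integral_averagingKernel_sub :
    Tendsto (fun h : EuclideanSpace ℝ (Fin n) =>
      ∫ y, |averagingKernel (y + h) - averagingKernel y|) (𝓝 0) (𝓝 0) := by
  have hcont := continuous_averagingKernel (n := n)
  have hlim : Tendsto (fun h : EuclideanSpace ℝ (Fin n) =>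
      ∫ y, |averagingKernel (y + h) - averagingKernel y|) (𝓝 0)
      (𝓝 (∫ _ : EuclideanSpace ℝ (Fin n), (0 : ℝ))) := by
    refine tendsto_integral_filter_of_dominated_convergence
      ((Metric.closedBall (0 : EuclideanSpace ℝ (Fin n)) 2).indicator fun _ => (1 : ℝ))
      (Eventually.of_forall fun h => Continuous.aestronglyMeasurable (by fun_prop)) ?_ ?_ ?_
    · filter_upwards [Metric.closedBall_mem_nhds (0 : EuclideanSpace ℝ (Fin n)) one_pos]
        with h hh
      rw [mem_closedBall_zero_iff] at hh
      refine Eventually.of_forall fun y => ?_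
      by_cases hy : y ∈ Metric.closedBall (0 : EuclideanSpace ℝ (Fin n)) 2
      · rw [Set.indicator_of_mem hy, Real.norm_eq_abs, abs_abs, abs_le]
        constructor <;>
          linarith [averagingKernel_nonneg y, averagingKernel_nonneg (y + h),
            averagingKernel_le_one y, averagingKernel_le_one (y + h)]
      · rw [Set.indicator_of_notMem hy]
        rw [mem_closedBall_zero_iff, not_le] at hy
        have hyh : ‖y‖ ≤ ‖y + h‖ + ‖h‖ := by simpa using norm_sub_le (y + h) h
        rw [averagingKernel_eq_zero (by linarith : 1 ≤ ‖y‖),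
          averagingKernel_eq_zero (by linarith : 1 ≤ ‖y + h‖)]
        simp
    · exact (integrable_indicator_iff measurableSet_closedBall).2
        (integrableOn_const (isCompact_closedBall _ _).measure_lt_top.ne)
    · refine Eventually.of_forall fun y => ?_
      have hc : Continuous fun h => |averagingKernel (y + h) - averagingKernel y| := by fun_prop
      simpa using hc.tendsto 0
  simpa using hlim

/-- Averages of a bounded function about two centres differ little on large balls. -/
lemma tendsto_ballAverage_sub {w : EuclideanSpace ℝ (Fin n) → ℝ} (hw : Continuous w) {M : ℝ}
    (hM : ∀ x, |w x| ≤ M) (x z : EuclideanSpace ℝ (Fin n)) :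
    Tendsto (fun r => ballAverage w z r - ballAverage w x r) atTop (𝓝 0) := by
  have hcont := continuous_averagingKernel (n := n)
  have hshift : Tendsto (fun r : ℝ => r⁻¹ • (x - z)) atTop (𝓝 0) := by
    simpa using (tendsto_inv_atTop_zero (𝕜 := ℝ)).smul_const (x - z)
  have hbound := (tendsto_integral_averagingKernel_sub.comp hshift).const_mul M
  rw [mul_zero] at hbound
  refine squeeze_zero_norm' ?_ hbound
  filter_upwards [eventually_gt_atTop 0] with r hr
  have htrans : ballAverage w z r =
      ∫ y, w (x + r • y) * averagingKernel (y + r⁻¹ • (x - z)) := by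
    rw [ballAverage, ← integral_add_right_eq_self _ (r⁻¹ • (x - z))]
    refine integral_congr_ae (Eventually.of_forall fun y => ?_)
    simp only [smul_add, smul_inv_smul₀ hr.ne']
    congr 2
    abel
  have hker : ∀ h : EuclideanSpace ℝ (Fin n), HasCompactSupport fun y => averagingKernel (y + h) :=
    fun h => hasCompactSupport_averagingKernel.comp_homeomorph (Homeomorph.addRight h)
  have hint1 : Integrable fun y => w (x + r • y) * averagingKernel (y + r⁻¹ • (x - z)) :=
    Continuous.integrable_of_hasCompactSupport (by fun_prop) (hker _).mul_left
  have hint2 : Integrable fun y => w (x + r • y) * averagingKernel y :=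
    integrable_mul_averagingKernel (by fun_prop)
  have hint3 : Integrable fun y : EuclideanSpace ℝ (Fin n) =>
      M * |averagingKernel (y + r⁻¹ • (x - z)) - averagingKernel y| :=
    (((Continuous.integrable_of_hasCompactSupport (by fun_prop) (hker _)).sub
      (hcont.integrable_of_hasCompactSupport hasCompactSupport_averagingKernel)).abs).const_mul M
  rw [htrans, ballAverage, ← integral_sub hint1 hint2]
  simp only [Function.comp_apply]
  rw [← integral_const_mul]
  refine norm_integral_le_of_norm_le hint3 (Eventually.of_forall fun y => ?_)
  rw [← mul_sub, norm_mul, Real.norm_eq_abs, Real.norm_eq_abs]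
  exact mul_le_mul_of_nonneg_right (hM _) (abs_nonneg _)

end Kernel

lemma exists_pow_sub_pow_le {M : ℝ} (hM : 0 ≤ M) (p : ℕ) :
    ∃ L : ℝ, 0 ≤ L ∧ ∀ a b : ℝ, 0 ≤ a → a ≤ b → b ≤ M → b ^ p - a ^ p ≤ L * (b - a) := by
  induction p with
  | zero => exact ⟨0, le_rfl, fun a b _ _ _ => by simp⟩
  | succ k ih =>
    obtain ⟨L, hL, h⟩ := ih
    refine ⟨M * L + M ^ k, by positivity, fun a b ha hab hb => ?_⟩
    have hak : a ^ k ≤ M ^ k := pow_le_pow_left₀ ha (hab.trans hb) k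
    calc b ^ (k + 1) - a ^ (k + 1) = b * (b ^ k - a ^ k) + a ^ k * (b - a) := by ring
      _ ≤ M * (L * (b - a)) + M ^ k * (b - a) := by
        have hdiff : 0 ≤ b ^ k - a ^ k := sub_nonneg.2 (pow_le_pow_left₀ ha hab k)
        have hba : 0 ≤ b - a := sub_nonneg.2 hab
        gcongr
        exact h a b ha hab hb
      _ = (M * L + M ^ k) * (b - a) := by ring

/-- A bounded nonnegative superharmonic function with a subharmonic power is constant. -/
lemma eq_of_lap_nonpos_of_lap_pow_nonneg {n : ℕ} {u : EuclideanSpace ℝ (Fin n) → ℝ}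
    (hu : ContDiff ℝ 2 u) (hu0 : ∀ x, 0 ≤ u x) {M : ℝ} (hM : ∀ x, u x ≤ M)
    (hsuper : ∀ x, lap u x ≤ 0) {p : ℕ} (hp : p ≠ 0)
    (hsub : ∀ x, 0 ≤ lap (fun y => u y ^ p) x) (x y : EuclideanSpace ℝ (Fin n)) :
    u x = u y := by
  set m : ℝ := ⨅ x, u x with hm
  have hbdd : BddBelow (Set.range u) := ⟨0, by rintro _ ⟨x, rfl⟩; exact hu0 x⟩
  have hmu : ∀ x, m ≤ u x := fun x => ciInf_le hbdd x
  have hm0 : 0 ≤ m := le_ciInf hu0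
  obtain ⟨L, hL, hLip⟩ := exists_pow_sub_pow_le ((hu0 0).trans (hM 0)) p
  set c : ℝ := ∫ y : EuclideanSpace ℝ (Fin n), averagingKernel y with hc
  have hcpos : 0 < c := integral_averagingKernel_pos
  have hucont := hu.continuous
  have hcomparison : ∀ x z, u z ^ p ≤ m ^ p + L * (u x - m) := by
    intro x z
    have hrad : ∀ r : ℝ, 0 ≤ r → u z ^ p * c ≤
        m ^ p * c + L * (u x * c - m * c) + L * (ballAverage u z r - ballAverage u x r) := by
      intro r hr
      have h1 := le_ballAverage_of_lap_nonneg (hu.pow p) hsub z hr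
      have h2 := ballAverage_le_of_lap_nonpos hu hsuper x hr
      have h3 : ballAverage (fun y => u y ^ p) z r ≤
          (m ^ p - L * m) * c + L * ballAverage u z r := by
        rw [hc, ballAverage, ballAverage, ← integral_const_mul, ← integral_const_mul,
          ← integral_add (integrable_mul_averagingKernel continuous_const)
            ((integrable_mul_averagingKernel (by fun_prop)).const_mul L)]
        refine integral_mono (integrable_mul_averagingKernel (by fun_prop))
          ((integrable_mul_averagingKernel continuous_const).add
            ((integrable_mul_averagingKernel (by fun_prop)).const_mul L)) fun y => ?_
        have h4 := mul_le_mul_of_nonneg_right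
          (hLip m (u (z + r • y)) hm0 (hmu _) (hM _)) (averagingKernel_nonneg y)
        dsimp only
        linarith
      have h5 := mul_le_mul_of_nonneg_left h2 hL
      simp only [← hc] at h1 h5
      linarith
    have hlim : Tendsto (fun r => m ^ p * c + L * (u x * c - m * c) +
        L * (ballAverage u z r - ballAverage u x r)) atTop
        (𝓝 (m ^ p * c + L * (u x * c - m * c) + L * 0)) :=
      ((tendsto_ballAverage_sub hucont
        (fun y => (abs_of_nonneg (hu0 y)).trans_le (hM y)) x z).const_mul L).const_add _
    have h6 := ge_of_tendsto hlim ((eventually_ge_atTop 0).mono hrad)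
    refine le_of_mul_le_mul_right ?_ hcpos
    linarith
  have hle : ∀ z, u z ≤ m := by
    intro z
    refine le_of_pow_le_pow_left₀ hp hm0 (le_of_forall_pos_le_add fun ε hε => ?_)
    have hL1 : 0 < L + 1 := by linarith
    obtain ⟨x, hx⟩ := exists_lt_of_ciInf_lt (show (⨅ x, u x) < m + ε / (L + 1) by
      rw [← hm]; linarith [div_pos hε hL1])
    have h7 : L * (u x - m) ≤ (L + 1) * (ε / (L + 1)) := by
      have := hmu x
      apply mul_le_mul <;> linarith
    rw [mul_div_cancel₀ _ hL1.ne'] at h7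
    linarith [hcomparison x z]
  exact (((hle x).antisymm (hmu x))).trans ((hle y).antisymm (hmu y)).symm

lemma norm_gradient_sq {n : ℕ} (u : EuclideanSpace ℝ (Fin n) → ℝ)
    (x : EuclideanSpace ℝ (Fin n)) :
    ‖gradient u x‖ ^ 2 = ∑ i, fderiv ℝ u x (EuclideanSpace.single i 1) ^ 2 := by
  rw [EuclideanSpace.norm_sq_eq]
  refine Finset.sum_congr rfl fun i _ => ?_
  rw [← inner_gradient_left, EuclideanSpace.inner_single_right]
  simp

lemma lap_pow_add_two {n : ℕ} {u : EuclideanSpace ℝ (Fin n) → ℝ} (hu : ContDiff ℝ 2 u) (k : ℕ)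
    (x : EuclideanSpace ℝ (Fin n)) :
    lap (fun y => u y ^ (k + 2)) x =
      (k + 2) * u x ^ k * (u x * lap u x + (k + 1) * ‖gradient u x‖ ^ 2) := by
  have hdiff : Differentiable ℝ u := hu.differentiable two_ne_zero
  have hpartial : ∀ i : Fin n,
      Differentiable ℝ fun y => fderiv ℝ u y (EuclideanSpace.single i (1 : ℝ)) := fun i =>
    ((hu.fderiv_right (m := 1) (by norm_num)).clm_apply contDiff_const).differentiable one_ne_zero
  have hpow : ∀ (j : ℕ) (y : EuclideanSpace ℝ (Fin n)), HasFDerivAt (fun z => u z ^ (j + 1))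
      (((j + 1 : ℝ) * u y ^ j) • fderiv ℝ u y) y := by
    intro j y
    have h := (hasDerivAt_pow (j + 1) (u y)).comp_hasFDerivAt y (hdiff y).hasFDerivAt
    simpa [Function.comp_def] using h
  rw [norm_gradient_sq, lap, lap, Finset.mul_sum, Finset.mul_sum, ← Finset.sum_add_distrib,
    Finset.mul_sum]
  refine Finset.sum_congr rfl fun i _ => ?_
  have hfirst : (fun y => fderiv ℝ (fun z => u z ^ (k + 2)) y (EuclideanSpace.single i (1 : ℝ))) =
      fun y => ((k + 2 : ℝ) * u y ^ (k + 1)) * fderiv ℝ u y (EuclideanSpace.single i 1) := by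
    ext y
    rw [(hpow (k + 1) y).fderiv]
    rw [smul_apply, smul_eq_mul]
    push_cast
    ring
  rw [hfirst, (((hpow k x).const_mul (k + 2 : ℝ)).fun_mul (hpartial i x).hasFDerivAt).fderiv]
  simp
  ring

/-- Scalar Liouville theorem for `0 ≤ -Δu` with `-u Δu ≤ K |∇u|²`. -/
lemma eq_of_mul_neg_lap_le {n : ℕ} {u : EuclideanSpace ℝ (Fin n) → ℝ}
    (hu : ContDiff ℝ 2 u) (hu0 : ∀ x, 0 ≤ u x) {M : ℝ} (hM : ∀ x, u x ≤ M)
    (hsuper : ∀ x, 0 ≤ -lap u x) {K : ℝ}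
    (hK : ∀ x, u x * -lap u x ≤ K * ‖gradient u x‖ ^ 2) (x y : EuclideanSpace ℝ (Fin n)) :
    u x = u y := by
  obtain ⟨k, hk⟩ := exists_nat_ge K
  refine eq_of_lap_nonpos_of_lap_pow_nonneg hu hu0 hM (fun z => neg_nonneg.1 (hsuper z))
    (p := k + 2) (by omega) (fun z => ?_) x y
  rw [lap_pow_add_two hu]
  have hz := hu0 z
  refine mul_nonneg (by positivity) ?_
  have hmono : K * ‖gradient u z‖ ^ 2 ≤ (k + 1) * ‖gradient u z‖ ^ 2 :=
    mul_le_mul_of_nonneg_right (by linarith) (sq_nonneg _)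
  linarith [hK z]

/-- **Liouville theorem for systems** (Theorem 1.2(i)): let `f, g` be nonnegative
nonlinearities such that for each `M > 0` there is `K(M) > 0` with
`u f(x,u,v,ξ,ζ) ≤ K(M)|ξ|²` and `v g(x,u,v,ξ,ζ) ≤ K(M)|ζ|²` for all `x ∈ ℝⁿ`,
`(u,v) ∈ [0,M]²` and all `ξ, ζ ∈ ℝⁿ`.  Then any nonnegative bounded classical solution
`(u, v)` of the system `-Δu = f(x,u,v,∇u,∇v)`, `-Δv = g(x,u,v,∇u,∇v)` is constant. -/
theorem liouville_system {n : ℕ} (hn : 1 ≤ n)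
    (f g : EuclideanSpace ℝ (Fin n) → ℝ → ℝ → EuclideanSpace ℝ (Fin n) →
      EuclideanSpace ℝ (Fin n) → ℝ)
    (hf_nonneg : ∀ x a b ξ ζ, 0 ≤ a → 0 ≤ b → 0 ≤ f x a b ξ ζ)
    (hg_nonneg : ∀ x a b ξ ζ, 0 ≤ a → 0 ≤ b → 0 ≤ g x a b ξ ζ)
    (hK : ∀ M : ℝ, 0 < M → ∃ K : ℝ, 0 < K ∧
      ∀ x (a b : ℝ) (ξ ζ : EuclideanSpace ℝ (Fin n)),
        a ∈ Set.Icc (0 : ℝ) M → b ∈ Set.Icc (0 : ℝ) M →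
          a * f x a b ξ ζ ≤ K * ‖ξ‖ ^ 2 ∧ b * g x a b ξ ζ ≤ K * ‖ζ‖ ^ 2)
    (u v : EuclideanSpace ℝ (Fin n) → ℝ)
    (hu_nonneg : ∀ x, 0 ≤ u x) (hv_nonneg : ∀ x, 0 ≤ v x)
    (hu_bdd : ∃ M : ℝ, ∀ x, u x ≤ M) (hv_bdd : ∃ M : ℝ, ∀ x, v x ≤ M)
    (hu_C2 : ContDiff ℝ 2 u) (hv_C2 : ContDiff ℝ 2 v)
    (hequ : ∀ x, -lap u x = f x (u x) (v x) (gradient u x) (gradient v x))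
    (heqv : ∀ x, -lap v x = g x (u x) (v x) (gradient u x) (gradient v x)) :
    (∀ x y, u x = u y) ∧ (∀ x y, v x = v y) := by
  obtain ⟨Mu, hMu⟩ := hu_bdd
  obtain ⟨Mv, hMv⟩ := hv_bdd
  obtain ⟨K, -, hK⟩ := hK (max (max Mu Mv) 1) (lt_max_of_lt_right one_pos)
  have hu_mem : ∀ x, u x ∈ Set.Icc (0 : ℝ) (max (max Mu Mv) 1) := fun x =>
    ⟨hu_nonneg x, le_max_of_le_left (le_max_of_le_left (hMu x))⟩
  have hv_mem : ∀ x, v x ∈ Set.Icc (0 : ℝ) (max (max Mu Mv) 1) := fun x =>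
    ⟨hv_nonneg x, le_max_of_le_left (le_max_of_le_right (hMv x))⟩
  refine ⟨eq_of_mul_neg_lap_le hu_C2 hu_nonneg hMu (fun x => ?_) (K := K) fun x => ?_,
    eq_of_mul_neg_lap_le hv_C2 hv_nonneg hMv (fun x => ?_) (K := K) fun x => ?_⟩
  · rw [hequ]
    exact hf_nonneg _ _ _ _ _ (hu_nonneg x) (hv_nonneg x)
  · rw [hequ]
    exact (hK x _ _ _ _ (hu_mem x) (hv_mem x)).1
  · rw [heqv]
    exact hg_nonneg _ _ _ _ _ (hu_nonneg x) (hv_nonneg x)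
  · rw [heqv]
    exact (hK x _ _ _ _ (hu_mem x) (hv_mem x)).2
end
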